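/- arXiv:2505.12035 — 2 statements merged into one kernel-verified Lean document; each statement's English description precedes it below -/
import Mathlib

section
/- Let n ≥ 6 and let H be a [3]-graph on n vertices such that every pair of non-adjacent vertices u, v satisfies d_{∂H}(u) + d_{∂H}(v) ≥ n + 65. Then H contains a Hamiltonian Berge cycle. -/
/-- Two vertices are adjacent in the hypergraph with edge set `H`
if some edge contains both of them. -/
def HAdj {V : Type*} (H : Finset (Finset V)) (u v : V) : Prop :=
  u ≠ v ∧ ∃ e ∈ H, u ∈ e ∧ v ∈ e

/-- The degree of `u` in the 2-shadow `∂H`: the number of vertices adjacent to `u`. -/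
noncomputable def shadowDeg {V : Type*} (H : Finset (Finset V)) (u : V) : ℕ :=
  {v | HAdj H u v}.ncard

/-- A `[3]`-graph: every edge has exactly 2 or 3 vertices. -/
def IsThreeGraph {V : Type*} (H : Finset (Finset V)) : Prop :=
  ∀ e ∈ H, e.card = 2 ∨ e.card = 3

/-- A Berge cycle of length `t` in the hypergraph with edge set `H`:
`t` distinct vertices `vtx i` and `t` distinct edges `edge i` (indices mod `t`)
with `{vtx i, vtx (i+1)} ⊆ edge i` for every `i`. -/
structure BergeCycle {V : Type*} (H : Finset (Finset V)) (t : ℕ) where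
  vtx : ZMod t → V
  edge : ZMod t → Finset V
  vtx_inj : Function.Injective vtx
  edge_inj : Function.Injective edge
  edge_mem : ∀ i, edge i ∈ H
  mem_fst : ∀ i, vtx i ∈ edge i
  mem_snd : ∀ i, vtx (i + 1) ∈ edge i

/-- `d_C(u)`: the number of vertices of the Berge cycle `C` adjacent to `u`. -/
noncomputable def BergeCycle.dC {V : Type*} {H : Finset (Finset V)} {t : ℕ}
    (C : BergeCycle H t) (u : V) : ℕ :=
  {v | v ∈ Set.range C.vtx ∧ HAdj H u v}.ncard

/-- `H` contains a Hamiltonian Berge cycle, i.e. a Berge cycle whose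
vertex set is all of `V`. -/
def HamiltonianBergeCycle {V : Type*} (H : Finset (Finset V)) : Prop :=
  ∃ (t : ℕ) (C : BergeCycle H t), Set.range C.vtx = Set.univ

/-- A set `U` of indices of vertices of the Berge cycle `C` is usable for `u`:
(1) for every `i ∈ U` there is an edge in `E(u, v_{i-1}) - {e_{i-2}}`;
(2) any two distinct `i, j ∈ U` are non-consecutive on `C`;
(3) for every pair of distinct `i, j ∈ U` there are distinct edges
`e ∈ E(u, v_{i-1}) - {e_{i-2}}` and `e' ∈ E(u, v_{j-1}) - {e_{j-2}}`. -/
def Usable {V : Type*} {H : Finset (Finset V)} {t : ℕ} (C : BergeCycle H t) (u : V)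
    (U : Set (ZMod t)) : Prop :=
  (∀ i ∈ U, ∃ e ∈ H, e ≠ C.edge (i - 2) ∧ u ∈ e ∧ C.vtx (i - 1) ∈ e) ∧
  (∀ i ∈ U, ∀ j ∈ U, i ≠ j → j ≠ i + 1 ∧ j ≠ i - 1) ∧
  (∀ i ∈ U, ∀ j ∈ U, i ≠ j → ∃ e ∈ H, ∃ e' ∈ H, e ≠ e' ∧
    e ≠ C.edge (i - 2) ∧ u ∈ e ∧ C.vtx (i - 1) ∈ e ∧
    e' ≠ C.edge (j - 2) ∧ u ∈ e' ∧ C.vtx (j - 1) ∈ e')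

/-- `CwBtw a b c` : on the cycle oriented clockwise, `b` lies strictly between
`a` and `c` on the clockwise arc from `a` to `c`. -/
def CwBtw {t : ℕ} (a b c : ZMod t) : Prop :=
  0 < (b - a).val ∧ (b - a).val < (c - a).val

/-- `e` is an `(i,j;k)`-bridge of the Berge cycle `C`. -/
def IsBridge {V : Type*} [DecidableEq V] {H : Finset (Finset V)} {t : ℕ}
    (C : BergeCycle H t) (i j k : ZMod t) (e : Finset V) : Prop :=
  (CwBtw i k j ∧ ((e = C.edge (k + 1) ∧ e = {C.vtx i, C.vtx (k + 1), C.vtx (k + 2)}) ∨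
                (e = C.edge (k - 1) ∧ e = {C.vtx j, C.vtx k, C.vtx (k - 1)}))) ∨
  (CwBtw j k i ∧ ((e = C.edge (k - 1) ∧ e = {C.vtx i, C.vtx k, C.vtx (k - 1)}) ∨
                (e = C.edge (k + 1) ∧ e = {C.vtx j, C.vtx (k + 1), C.vtx (k + 2)})))

/-- `R(v_i, v_j)`: the set of bridges produced by the pair `{v_i, v_j}`,
i.e. all `(i,j;k)`-bridges over `k ∉ {i, j}`. -/
def RBridges {V : Type*} [DecidableEq V] {H : Finset (Finset V)} {t : ℕ}
    (C : BergeCycle H t) (i j : ZMod t) : Set (Finset V) :=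
  {e | ∃ k : ZMod t, k ≠ i ∧ k ≠ j ∧ IsBridge C i j k e}


/-! ### Six vertices: a finite search -/

namespace SixSearch

def key (a b : ℕ) : ℕ := if a < b then 6 * a + b else 6 * b + a

def look : List (ℕ × ℕ) → ℕ → ℕ
  | [], _ => 7
  | (p, v) :: l, q => if p = q then v else look l q

/-- the cherry `u v w` is certainly fine, given the partial assignment. -/
def cherry (a : List (ℕ × ℕ)) (u v w : ℕ) : Bool :=
  (look a (key u v) != 7 && look a (key u v) != w) ||
  (look a (key v w) != 7 && look a (key v w) != u)

def good (a : List (ℕ × ℕ)) : List ℕ → Bool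
  | [p, q, r, s, t, u] => cherry a p q r && cherry a q r s && cherry a r s t && cherry a s t u &&
      cherry a t u p && cherry a u p q
  | _ => false

def cycles : List (List ℕ) :=
  [[0, 1, 2, 3, 4, 5], [0, 1, 2, 3, 5, 4], [0, 1, 2, 4, 3, 5], [0, 1, 2, 4, 5, 3],
   [0, 1, 2, 5, 3, 4], [0, 1, 2, 5, 4, 3], [0, 1, 3, 2, 4, 5], [0, 1, 3, 2, 5, 4],
   [0, 1, 3, 4, 2, 5], [0, 1, 3, 4, 5, 2], [0, 1, 3, 5, 2, 4], [0, 1, 3, 5, 4, 2],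
   [0, 1, 4, 2, 3, 5], [0, 1, 4, 2, 5, 3], [0, 1, 4, 3, 2, 5], [0, 1, 4, 3, 5, 2],
   [0, 1, 4, 5, 2, 3], [0, 1, 4, 5, 3, 2], [0, 1, 5, 2, 3, 4], [0, 1, 5, 2, 4, 3],
   [0, 1, 5, 3, 2, 4], [0, 1, 5, 3, 4, 2], [0, 1, 5, 4, 2, 3], [0, 1, 5, 4, 3, 2],
   [0, 2, 1, 3, 4, 5], [0, 2, 1, 3, 5, 4], [0, 2, 1, 4, 3, 5], [0, 2, 1, 4, 5, 3],
   [0, 2, 1, 5, 3, 4], [0, 2, 1, 5, 4, 3], [0, 2, 3, 1, 4, 5], [0, 2, 3, 1, 5, 4],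
   [0, 2, 3, 4, 1, 5], [0, 2, 3, 5, 1, 4], [0, 2, 4, 1, 3, 5], [0, 2, 4, 1, 5, 3],
   [0, 2, 4, 3, 1, 5], [0, 2, 4, 5, 1, 3], [0, 2, 5, 1, 3, 4], [0, 2, 5, 1, 4, 3],
   [0, 2, 5, 3, 1, 4], [0, 2, 5, 4, 1, 3], [0, 3, 1, 2, 4, 5], [0, 3, 1, 2, 5, 4],
   [0, 3, 1, 4, 2, 5], [0, 3, 1, 5, 2, 4], [0, 3, 2, 1, 4, 5], [0, 3, 2, 1, 5, 4],
   [0, 3, 2, 4, 1, 5], [0, 3, 2, 5, 1, 4], [0, 3, 4, 1, 2, 5], [0, 3, 4, 2, 1, 5],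
   [0, 3, 5, 1, 2, 4], [0, 3, 5, 2, 1, 4], [0, 4, 1, 2, 3, 5], [0, 4, 1, 3, 2, 5],
   [0, 4, 2, 1, 3, 5], [0, 4, 2, 3, 1, 5], [0, 4, 3, 1, 2, 5], [0, 4, 3, 2, 1, 5]]

def order : List ℕ := [1, 15, 29, 22, 17, 5, 10, 16, 23, 3, 9, 2, 4, 11, 8]

def srch : List ℕ → List (ℕ × ℕ) → Bool
  | [], a => cycles.any (good a)
  | p :: ps, a => cycles.any (good a) ||
      [0, 1, 2, 3, 4, 5, 6].all (fun v => v == p / 6 || v == p % 6 || srch ps ((p, v) :: a))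

theorem srch_order : srch order [] = true := by decide +kernel

def ch (τ : ℕ → ℕ) (u v w : ℕ) : Prop := τ (key u v) ≠ w ∨ τ (key v w) ≠ u

theorem look_spec (τ : ℕ → ℕ) (a : List (ℕ × ℕ)) (ha : ∀ x ∈ a, τ x.1 = x.2) (q : ℕ) :
    look a q = 7 ∨ look a q = τ q := by
  induction a with
  | nil => left; rfl
  | cons x l ih =>
    obtain ⟨p, v⟩ := x
    have h1 := ha (p, v) (by simp)
    have h2 := ih (fun x hx => ha x (by simp [hx]))
    simp only [look]
    split_ifs with h
    · right; subst h; exact h1.symm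
    · exact h2

theorem cherry_spec (τ : ℕ → ℕ) (a : List (ℕ × ℕ)) (ha : ∀ x ∈ a, τ x.1 = x.2) (u v w : ℕ)
    (h : cherry a u v w = true) : ch τ u v w := by
  have h1 := look_spec τ a ha (key u v)
  have h2 := look_spec τ a ha (key v w)
  simp only [cherry, Bool.or_eq_true, Bool.and_eq_true, bne_iff_ne] at h
  unfold ch
  grind

def Good (τ : ℕ → ℕ) (p q r s t u : ℕ) : Prop :=
  ch τ p q r ∧ ch τ q r s ∧ ch τ r s t ∧ ch τ s t u ∧ ch τ t u p ∧ ch τ u p q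

theorem any_spec (τ : ℕ → ℕ) (a : List (ℕ × ℕ)) (ha : ∀ x ∈ a, τ x.1 = x.2)
    (h : cycles.any (good a) = true) :
    ∃ p q r s t u, [p, q, r, s, t, u] ∈ cycles ∧ Good τ p q r s t u := by
  rw [List.any_eq_true] at h
  obtain ⟨c, hc, hg⟩ := h
  match c, hc, hg with
  | [p, q, r, s, t, u], hc, hg =>
    refine ⟨p, q, r, s, t, u, hc, ?_⟩
    simp only [good, Bool.and_eq_true] at hg
    obtain ⟨⟨⟨⟨⟨h1, h2⟩, h3⟩, h4⟩, h5⟩, h6⟩ := hg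
    exact ⟨cherry_spec τ a ha _ _ _ h1, cherry_spec τ a ha _ _ _ h2, cherry_spec τ a ha _ _ _ h3,
      cherry_spec τ a ha _ _ _ h4, cherry_spec τ a ha _ _ _ h5, cherry_spec τ a ha _ _ _ h6⟩

theorem srch_spec (τ : ℕ → ℕ) (h6 : ∀ p, τ p ≤ 6) (ps : List ℕ)
    (hps : ∀ p ∈ ps, τ p ≠ p / 6 ∧ τ p ≠ p % 6)
    (a : List (ℕ × ℕ)) (ha : ∀ x ∈ a, τ x.1 = x.2) (h : srch ps a = true) :
    ∃ p q r s t u, [p, q, r, s, t, u] ∈ cycles ∧ Good τ p q r s t u := by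
  induction ps generalizing a with
  | nil => exact any_spec τ a ha h
  | cons p ps ih =>
    simp only [srch, Bool.or_eq_true] at h
    rcases h with h | h
    · exact any_spec τ a ha h
    · rw [List.all_eq_true] at h
      have hm : τ p ∈ [0, 1, 2, 3, 4, 5, 6] := by
        have := h6 p
        simp only [List.mem_cons, List.not_mem_nil]
        omega
      have h1 := h _ hm
      have h2 := hps p (by simp)
      simp only [Bool.or_eq_true, beq_iff_eq] at h1
      rcases h1 with (h1 | h1) | h1
      · exact absurd h1 h2.1
      · exact absurd h1 h2.2
      · refine ih (fun q hq => hps q (by simp [hq])) _ ?_ h1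
        intro x hx
        rcases List.mem_cons.1 hx with rfl | hx
        · rfl
        · exact ha x hx

theorem cycles_spec : ∀ c ∈ cycles, c.Nodup ∧ (∀ x ∈ c, x < 6) := by
  decide +kernel

theorem exists_good (τ : ℕ → ℕ) (h6 : ∀ p, τ p ≤ 6)
    (hps : ∀ p ∈ order, τ p ≠ p / 6 ∧ τ p ≠ p % 6) :
    ∃ p q r s t u, ([p, q, r, s, t, u].Nodup ∧ ∀ x ∈ [p, q, r, s, t, u], x < 6) ∧
      Good τ p q r s t u := by
  obtain ⟨p, q, r, s, t, u, h, hg⟩ := srch_spec τ h6 order hps [] (by simp) srch_order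
  exact ⟨p, q, r, s, t, u, cycles_spec _ h, hg⟩

end SixSearch

/-! ### Berge paths -/

/-- `v 0, ..., v m` are distinct, `e 0, ..., e (m-1)` are distinct, `v i, v (i+1) ∈ e i`. -/
def IsBP {V : Type*} (m : ℕ) (v : ℕ → V) (e : ℕ → Finset V) : Prop :=
  (∀ i ≤ m, ∀ j ≤ m, v i = v j → i = j) ∧
  (∀ i < m, ∀ j < m, e i = e j → i = j) ∧
  (∀ i < m, v i ∈ e i ∧ v (i + 1) ∈ e i)

open Classical in
/-- There is a Berge path with vertex set `W`, edge set `E`, `m` edges, from `x` to `y`. -/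
def Pth {V : Type*} (W : Finset V) (m : ℕ) (E : Finset (Finset V)) (x y : V) : Prop :=
  ∃ (v : ℕ → V) (e : ℕ → Finset V), IsBP m v e ∧ v 0 = x ∧ v m = y ∧
    (Finset.range (m + 1)).image v = W ∧ (Finset.range m).image e = E

open Classical in
theorem IsBP.rot {V : Type*} {m : ℕ} {v : ℕ → V} {e : ℕ → Finset V} (hP : IsBP m v e)
    {W : Finset V} {E : Finset (Finset V)}
    (hW : (Finset.range (m + 1)).image v = W) (hE : (Finset.range m).image e = E)
    {j : ℕ} (hj : j < m) {h : Finset V} (h0 : v 0 ∈ h) (h1 : v (j + 1) ∈ h)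
    (hh : h = e j ∨ h ∉ E) : Pth W m (insert h (E.erase (e j))) (v j) (v m) := by
  obtain ⟨hv, he, hve⟩ := hP
  have hne : ∀ i < m, i ≠ j → e i ≠ h := by
    rintro i hi hij rfl
    rcases hh with hh | hh
    · exact hij (he _ hi _ hj hh)
    · exact hh (hE ▸ Finset.mem_image_of_mem e (Finset.mem_range.2 hi))
  refine ⟨fun i => if i ≤ j then v (j - i) else v i,
    fun i => if i < j then e (j - 1 - i) else if i = j then h else e i,
    ⟨?_, ?_, ?_⟩, ?_, ?_, ?_, ?_⟩
  · intro a ha b hb hab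
    dsimp only at hab
    split_ifs at hab with h1 h2 h2
    · have := hv _ (by omega) _ (by omega) hab; omega
    · have := hv _ (by omega) _ (by omega) hab; omega
    · have := hv _ (by omega) _ (by omega) hab; omega
    · exact hv _ ha _ hb hab
  · intro a ha b hb hab
    dsimp only at hab
    split_ifs at hab with h1 h2 h3 h4 h5 h6 h7 h8
    · have := he _ (by omega) _ (by omega) hab; omega
    · exact absurd hab (hne _ (by omega) (by omega))
    · have := he _ (by omega) _ (by omega) hab; omega
    · exact absurd hab.symm (hne _ (by omega) (by omega))
    · omega
    · exact absurd hab.symm (hne _ (by omega) (by omega))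
    · have := he _ (by omega) _ (by omega) hab; omega
    · exact absurd hab (hne _ (by omega) (by omega))
    · exact he _ ha _ hb hab
  · intro i hi
    dsimp only
    rcases lt_trichotomy i j with hij | rfl | hij
    · have := hve (j - 1 - i) (by omega)
      rw [if_pos hij.le, if_pos (by omega : i + 1 ≤ j), if_pos hij]
      rw [show j - 1 - i + 1 = j - i by omega] at this
      rw [show j - (i + 1) = j - 1 - i by omega]
      exact ⟨this.2, this.1⟩
    · simp [h0, h1]
    · have := hve i hi
      rw [if_neg (by omega), if_neg (by omega), if_neg (by omega), if_neg (by omega)]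
      exact this
  · simp
  · simp only [if_neg (not_le.2 hj)]
  · rw [← hW]
    ext z
    simp only [Finset.mem_image, Finset.mem_range]
    constructor
    · rintro ⟨i, hi, rfl⟩
      split_ifs with h2
      · exact ⟨j - i, by omega, rfl⟩
      · exact ⟨i, hi, rfl⟩
    · rintro ⟨i, hi, rfl⟩
      by_cases h2 : i ≤ j
      · exact ⟨j - i, by omega, by rw [if_pos (by omega), show j - (j - i) = i by omega]⟩
      · exact ⟨i, hi, by rw [if_neg h2]⟩
  · rw [← hE]
    ext z
    simp only [Finset.mem_image, Finset.mem_range, Finset.mem_insert, Finset.mem_erase]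
    constructor
    · rintro ⟨i, hi, rfl⟩
      split_ifs with h2 h3
      · right
        exact ⟨fun hc => by have := he _ (by omega) _ hj hc; omega, _, by omega, rfl⟩
      · left; rfl
      · right
        exact ⟨fun hc => h3 (he _ hi _ hj hc), _, hi, rfl⟩
    · rintro (rfl | ⟨hz, i, hi, rfl⟩)
      · exact ⟨j, hj, by simp⟩
      · rcases lt_trichotomy i j with hij | rfl | hij
        · exact ⟨j - 1 - i, by omega, by
            rw [if_pos (by omega), show j - 1 - (j - 1 - i) = i by omega]⟩
        · exact absurd rfl hz
        · exact ⟨i, hi, by rw [if_neg (by omega), if_neg (by omega)]⟩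

theorem Pth.symm {V : Type*} {W : Finset V} {m : ℕ} {E : Finset (Finset V)} {x y : V}
    (h : Pth W m E x y) : Pth W m E y x := by
  classical
  obtain ⟨v, e, ⟨hv, he, hve⟩, h0, hm, hW, hE⟩ := h
  refine ⟨fun i => v (m - i), fun i => e (m - 1 - i), ⟨?_, ?_, ?_⟩, by simpa using hm,
    by simpa using h0, ?_, ?_⟩
  · intro a ha b hb hab
    have := hv _ (by omega) _ (by omega) hab; omega
  · intro a ha b hb hab
    have := he _ (by omega) _ (by omega) hab; omega
  · intro i hi
    have := hve (m - 1 - i) (by omega)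
    rw [show m - 1 - i + 1 = m - i by omega] at this
    dsimp only
    rw [show m - (i + 1) = m - 1 - i by omega]
    exact ⟨this.2, this.1⟩
  · rw [← hW]
    ext z
    simp only [Finset.mem_image, Finset.mem_range]
    constructor
    · rintro ⟨i, hi, rfl⟩
      exact ⟨m - i, by omega, rfl⟩
    · rintro ⟨i, hi, rfl⟩
      exact ⟨m - i, by omega, by rw [show m - (m - i) = i by omega]⟩
  · rw [← hE]
    ext z
    simp only [Finset.mem_image, Finset.mem_range]
    constructor
    · rintro ⟨i, hi, rfl⟩
      exact ⟨m - 1 - i, by omega, rfl⟩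
    · rintro ⟨i, hi, rfl⟩
      exact ⟨m - 1 - i, by omega, by rw [show m - 1 - (m - 1 - i) = i by omega]⟩

/-- Closing a Berge path gives a Berge cycle. -/
theorem Pth.close {V : Type*} {W : Finset V} {m : ℕ} {E : Finset (Finset V)} {x y : V}
    (hP : Pth W m E x y) {h : Finset V} (hx : x ∈ h) (hy : y ∈ h) (hh : h ∉ E)
    {H : Finset (Finset V)} (hH : h ∈ H) (hEH : E ⊆ H) :
    ∃ C : BergeCycle H (m + 1), Set.range C.vtx = W ∧
      Set.range C.edge = insert h (E : Set (Finset V)) := by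
  classical
  obtain ⟨v, e, ⟨hv, he, hve⟩, rfl, rfl, hW, hE⟩ := hP
  have hle : ∀ i : ZMod (m + 1), i.val ≤ m := fun i => Nat.lt_succ_iff.1 (ZMod.val_lt i)
  have hmem : ∀ i < m, e i ∈ E := fun i hi =>
    hE ▸ Finset.mem_image_of_mem e (Finset.mem_range.2 hi)
  have hval : ∀ i ≤ m, ((i : ℕ) : ZMod (m + 1)).val = i := fun i hi =>
    ZMod.val_natCast_of_lt (Nat.lt_succ_iff.2 hi)
  have hsucc : ∀ i : ZMod (m + 1), (i + 1).val = if i.val < m then i.val + 1 else 0 := by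
    intro i
    have h1 : i + 1 = ((i.val + 1 : ℕ) : ZMod (m + 1)) := by simp
    split_ifs with h2
    · rw [h1, hval _ (by omega)]
    · have : i.val = m := le_antisymm (hle i) (not_lt.1 h2)
      rw [h1, this, ZMod.natCast_self, ZMod.val_zero]
  refine ⟨⟨fun i => v i.val, fun i => if i.val < m then e i.val else h, ?_, ?_, ?_, ?_, ?_⟩, ?_, ?_⟩
  · intro a b hab
    exact ZMod.val_injective _ (hv _ (hle a) _ (hle b) hab)
  · intro a b hab
    have ha := hle a
    have hb := hle b
    apply ZMod.val_injective
    dsimp only at hab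
    split_ifs at hab with h1 h2 h2
    · exact he _ h1 _ h2 hab
    · exact absurd (hab ▸ hmem _ h1) hh
    · exact absurd (hab ▸ hmem _ h2) hh
    · omega
  · intro i
    split_ifs with h1
    · exact hEH (hmem _ h1)
    · exact hH
  · intro i
    have := hle i
    split_ifs with h1
    · exact (hve _ h1).1
    · rw [show i.val = m by omega]; exact hy
  · intro i
    rw [hsucc]
    split_ifs with h1
    · exact (hve _ h1).2
    · exact hx
  · ext z
    simp only [Set.mem_range, ← hW, Finset.coe_image, Finset.coe_range, Set.mem_image, Set.mem_Iio]
    constructor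
    · rintro ⟨i, rfl⟩
      exact ⟨i.val, ZMod.val_lt i, rfl⟩
    · rintro ⟨i, hi, rfl⟩
      exact ⟨(i : ZMod (m + 1)), by rw [hval i (by omega)]⟩
  · ext z
    simp only [Set.mem_range, ← hE, Finset.coe_image, Finset.coe_range, Set.mem_image, Set.mem_Iio,
      Set.mem_insert_iff]
    constructor
    · rintro ⟨i, rfl⟩
      split_ifs with h1
      · exact Or.inr ⟨i.val, h1, rfl⟩
      · exact Or.inl rfl
    · rintro (rfl | ⟨i, hi, rfl⟩)
      · exact ⟨(m : ZMod (m + 1)), by rw [hval m le_rfl]; simp⟩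
      · exact ⟨(i : ZMod (m + 1)), by rw [hval i hi.le, if_pos hi]⟩

/-- Opening a Berge cycle at the edge `i`. -/
theorem BergeCycle.openAt {V : Type*} {H : Finset (Finset V)} {m : ℕ} (C : BergeCycle H (m + 1))
    {W : Finset V} (hW : Set.range C.vtx = W) (i : ZMod (m + 1)) :
    ∃ E : Finset (Finset V), Pth W m E (C.vtx (i + 1)) (C.vtx i) ∧
      (∀ f, f ∈ E ↔ f ≠ C.edge i ∧ ∃ k, C.edge k = f) := by
  classical
  have hinj : ∀ a ≤ m, ∀ b ≤ m, (i + 1 + (a : ZMod (m + 1))) = i + 1 + (b : ZMod (m + 1)) → a = b := by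
    intro a ha b hb hab
    have h1 : (a : ZMod (m + 1)) = b := by simpa using hab
    have h2 := congrArg ZMod.val h1
    rwa [ZMod.val_natCast_of_lt (by omega), ZMod.val_natCast_of_lt (by omega)] at h2
  have hm : i + 1 + (m : ZMod (m + 1)) = i := by
    have : ((m + 1 : ℕ) : ZMod (m + 1)) = 0 := ZMod.natCast_self _
    push_cast at this
    rw [add_assoc, add_comm 1, this, add_zero]
  have hsurj : ∀ k : ZMod (m + 1), ∃ a ≤ m, i + 1 + (a : ZMod (m + 1)) = k := by
    intro k
    refine ⟨(k - (i + 1)).val, Nat.lt_succ_iff.1 (ZMod.val_lt _), ?_⟩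
    simp
  refine ⟨(Finset.range m).image (fun a : ℕ => C.edge (i + 1 + a)),
    ⟨fun a : ℕ => C.vtx (i + 1 + a), fun a : ℕ => C.edge (i + 1 + a), ⟨?_, ?_, ?_⟩, by simp,
      by simp only [hm], ?_, rfl⟩, ?_⟩
  · intro a ha b hb hab
    exact hinj a ha b hb (C.vtx_inj hab)
  · intro a ha b hb hab
    exact hinj a ha.le b hb.le (C.edge_inj hab)
  · intro a ha
    refine ⟨C.mem_fst _, ?_⟩
    have := C.mem_snd (i + 1 + a)
    push_cast
    rwa [← add_assoc]
  · apply Finset.coe_injective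
    rw [← hW]
    ext z
    simp only [Finset.coe_image, Finset.coe_range, Set.mem_image, Set.mem_Iio, Set.mem_range]
    constructor
    · rintro ⟨a, _, rfl⟩
      exact ⟨_, rfl⟩
    · rintro ⟨k, rfl⟩
      obtain ⟨a, ha, rfl⟩ := hsurj k
      exact ⟨a, by omega, rfl⟩
  · intro f
    simp only [Finset.mem_image, Finset.mem_range]
    constructor
    · rintro ⟨a, ha, rfl⟩
      refine ⟨fun hc => ?_, _, rfl⟩
      have := hinj a ha.le m le_rfl (by
        have h2 := C.edge_inj hc
        rw [h2, hm])
      omega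
    · rintro ⟨hf, k, rfl⟩
      obtain ⟨a, ha, rfl⟩ := hsurj k
      refine ⟨a, lt_of_le_of_ne ha ?_, rfl⟩
      rintro rfl
      exact hf (by rw [hm])

/-! ### The Ore-type exchange argument -/

open Classical in
/-- number of edges of `E` through `x`. -/
noncomputable def degE {V : Type*} (E : Finset (Finset V)) (x : V) : ℕ :=
  (E.filter (fun f => x ∈ f)).card

open Classical in
theorem nbr_count {V : Type*} [Fintype V] {m : ℕ} {H E : Finset (Finset V)} {x : V}
    {p : ℕ → V} {e : ℕ → Finset V} (hE : (Finset.range m).image e = E)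
    (hinj : ∀ i < m, ∀ j < m, e i = e j → i = j)
    (hc : ∀ f ∈ E, f.card ≤ 3) (hp : ∀ z, z ≠ x → ∃ j < m, p j = z)
    (hpe : ∀ j < m, p j ∈ e j) (hpx : ∀ j < m, p j ≠ x) :
    shadowDeg H x ≤ ((Finset.range m).filter (fun j => ∃ h ∈ H, x ∈ h ∧ p j ∈ h ∧
      (h = e j ∨ h ∉ E))).card + degE E x := by
  set A := (Finset.range m).filter (fun j => ∃ h ∈ H, x ∈ h ∧ p j ∈ h ∧ (h = e j ∨ h ∉ E)) with hA
  set K := (Finset.range m).filter (fun j => x ∈ e j) with hK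
  have hKc : K.card ≤ degE E x := by
    unfold degE
    rw [← Finset.card_image_of_injOn (s := K) (f := e)]
    · apply Finset.card_le_card
      intro f hf
      obtain ⟨k, hk, rfl⟩ := Finset.mem_image.1 hf
      rw [hK, Finset.mem_filter] at hk
      exact Finset.mem_filter.2 ⟨hE ▸ Finset.mem_image_of_mem e hk.1, hk.2⟩
    · intro a ha b hb hab
      have ha' := Finset.mem_filter.1 (Finset.mem_coe.1 ha)
      have hb' := Finset.mem_filter.1 (Finset.mem_coe.1 hb)
      exact hinj a (Finset.mem_range.1 ha'.1) b (Finset.mem_range.1 hb'.1) hab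
  have hsub : {z | HAdj H x z} ⊆
      ((A.image p ∪ K.biUnion (fun k => ((e k).erase x).erase (p k)) : Finset V) : Set V) := by
    rintro z ⟨hxz, h, hh, hx, hz⟩
    obtain ⟨j, hj, rfl⟩ := hp z hxz.symm
    simp only [Finset.coe_union, Set.mem_union, Finset.mem_coe, Finset.mem_image,
      Finset.mem_biUnion, Finset.mem_erase]
    by_cases hhE : h ∈ E
    · rw [← hE] at hhE
      obtain ⟨k, hk, rfl⟩ := Finset.mem_image.1 hhE
      by_cases hpk : p j = p k
      · left
        refine ⟨k, Finset.mem_filter.2 ⟨hk, e k, hh, hx, hpk ▸ hz, Or.inl rfl⟩, hpk.symm⟩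
      · right
        exact ⟨k, Finset.mem_filter.2 ⟨hk, hx⟩, hpk, hxz.symm, hz⟩
    · left
      exact ⟨j, Finset.mem_filter.2 ⟨Finset.mem_range.2 hj, h, hh, hx, hz, Or.inr hhE⟩, rfl⟩
  have hle : shadowDeg H x ≤ (A.image p ∪ K.biUnion (fun k => ((e k).erase x).erase (p k))).card := by
    unfold shadowDeg
    rw [← Set.ncard_coe_finset]
    exact Set.ncard_le_ncard hsub (Finset.finite_toSet _)
  have h1 : (K.biUnion (fun k => ((e k).erase x).erase (p k))).card ≤ K.card * 1 := by
    apply Finset.card_biUnion_le_card_mul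
    intro k hk
    have hk' := Finset.mem_filter.1 hk
    have hkm := Finset.mem_range.1 hk'.1
    rw [Finset.card_erase_of_mem (Finset.mem_erase.2 ⟨hpx k hkm, hpe k hkm⟩),
      Finset.card_erase_of_mem hk'.2]
    have := hc (e k) (hE ▸ Finset.mem_image_of_mem e hk'.1)
    omega
  have h2 := Finset.card_union_le (A.image p) (K.biUnion (fun k => ((e k).erase x).erase (p k)))
  have h3 : (A.image p).card ≤ A.card := Finset.card_image_le
  omega

/-- The outcome of an improvement step. -/
def Improves {V : Type*} (W : Finset V) (m : ℕ) (H E : Finset (Finset V)) : Prop :=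
  ∃ (E' : Finset (Finset V)) (x y : V) (h : Finset V), Pth W m E' x y ∧ h ∉ E' ∧ x ∈ h ∧ y ∈ h ∧
    h ∈ H ∧ ∀ f ∈ E', f ∈ E ∨ f ∈ H

theorem crossing {V : Type*} [Fintype V] {m : ℕ} {H E : Finset (Finset V)} {x y : V}
    (hP : Pth Finset.univ m E x y) (hc : ∀ f ∈ E, f.card ≤ 3) (hna : ¬ HAdj H x y) (hxy : x ≠ y)
    (hd : m + degE E x + degE E y < shadowDeg H x + shadowDeg H y) :
    Improves Finset.univ m H E := by
  classical
  obtain ⟨v, e, hBP, rfl, rfl, hW, hE⟩ := hP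
  obtain ⟨hv, he, hve⟩ := hBP
  have hsurj : ∀ z, ∃ i ≤ m, v i = z := by
    intro z
    have : z ∈ (Finset.range (m + 1)).image v := by rw [hW]; exact Finset.mem_univ z
    obtain ⟨i, hi, rfl⟩ := Finset.mem_image.1 this
    exact ⟨i, Nat.lt_succ_iff.1 (Finset.mem_range.1 hi), rfl⟩
  have h1 := nbr_count (H := H) (x := v 0) (p := fun j => v (j + 1)) hE he hc
    (by
      intro z hz
      obtain ⟨i, hi, rfl⟩ := hsurj z
      have : i ≠ 0 := by rintro rfl; exact hz rfl
      exact ⟨i - 1, by omega, by rw [Nat.sub_add_cancel (by omega)]⟩)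
    (fun j hj => (hve j hj).2) (fun j hj hc => by have := hv _ (by omega) _ (by omega) hc; omega)
  have h2 := nbr_count (H := H) (x := v m) (p := fun j => v j) hE he hc
    (by
      intro z hz
      obtain ⟨i, hi, rfl⟩ := hsurj z
      have : i ≠ m := by rintro rfl; exact hz rfl
      exact ⟨i, by omega, rfl⟩)
    (fun j hj => (hve j hj).1) (fun j hj hc => by have := hv _ (by omega) _ (by omega) hc; omega)
  set A := (Finset.range m).filter (fun j => ∃ h ∈ H, v 0 ∈ h ∧ v (j + 1) ∈ h ∧ (h = e j ∨ h ∉ E))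
  set B := (Finset.range m).filter (fun j => ∃ h ∈ H, v m ∈ h ∧ v j ∈ h ∧ (h = e j ∨ h ∉ E))
  have hAB : (A ∩ B).Nonempty := by
    rw [← Finset.card_pos]
    have h3 := Finset.card_union_add_card_inter A B
    have h4 : (A ∪ B).card ≤ m := by
      calc _ ≤ (Finset.range m).card := Finset.card_le_card
              (Finset.union_subset (Finset.filter_subset _ _) (Finset.filter_subset _ _))
        _ = m := Finset.card_range m
    omega
  obtain ⟨j, hj⟩ := hAB
  rw [Finset.mem_inter] at hj
  obtain ⟨hjm, h, hh, hx, hz, hd1⟩ := Finset.mem_filter.1 hj.1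
  obtain ⟨_, h', hh', hy, hz', hd2⟩ := Finset.mem_filter.1 hj.2
  have hjm' := Finset.mem_range.1 hjm
  refine ⟨insert h (E.erase (e j)), v j, v m, h', 
    IsBP.rot ⟨hv, he, hve⟩ hW hE hjm' hx hz hd1, ?_, hz', hy, hh', ?_⟩
  · rw [Finset.mem_insert, Finset.mem_erase]
    rintro (rfl | ⟨h3, h4⟩)
    · exact hna ⟨hxy, h', hh, hx, hy⟩
    · rcases hd2 with h5 | h5
      · exact h3 h5
      · exact h5 h4
  · intro f hf
    rw [Finset.mem_insert, Finset.mem_erase] at hf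
    rcases hf with rfl | hf
    · exact Or.inr hh
    · exact Or.inl hf.2

open Classical in
/-- edges meeting `S` twice. -/
noncomputable def E2 {V : Type*} (E : Finset (Finset V)) (S : Finset V) : Finset (Finset V) :=
  E.filter (fun f => 2 ≤ (f ∩ S).card)

theorem E2_bounds {V : Type*} {W : Finset V} {m : ℕ} {E : Finset (Finset V)} {x y : V}
    (hP : Pth W m E x y) (hc : ∀ f ∈ E, f.card ≤ 3) {S : Finset V} (hx : x ∈ S) :
    (E2 E S).card + 1 ≤ 2 * S.card ∧
      ∑ z ∈ S, degE (E2 E S) z + 2 ≤ 4 * S.card := by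
  classical
  obtain ⟨v, e, ⟨hv, he, hve⟩, rfl, rfl, hW, hE⟩ := hP
  set J := (Finset.range m).filter (fun j => 2 ≤ (e j ∩ S).card) with hJ
  have hEJ : E2 E S = J.image e := by
    ext f
    simp only [E2, ← hE, Finset.mem_filter, Finset.mem_image, hJ]
    constructor
    · rintro ⟨⟨a, ha, rfl⟩, h⟩
      exact ⟨a, ⟨ha, h⟩, rfl⟩
    · rintro ⟨a, ⟨ha, h⟩, rfl⟩
      exact ⟨⟨a, ha, rfl⟩, h⟩
  have hJinj : Set.InjOn e J := by
    intro a ha b hb hab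
    have ha' := Finset.mem_filter.1 (Finset.mem_coe.1 ha)
    have hb' := Finset.mem_filter.1 (Finset.mem_coe.1 hb)
    exact he a (Finset.mem_range.1 ha'.1) b (Finset.mem_range.1 hb'.1) hab
  set A := (Finset.range m).filter (fun j => v j ∈ S)
  set B := (Finset.range m).filter (fun j => v (j + 1) ∈ S)
  have hA : A.card ≤ S.card := by
    apply Finset.card_le_card_of_injOn v
    · intro a ha
      exact (Finset.mem_filter.1 ha).2
    · intro a ha b hb hab
      have ha' := Finset.mem_range.1 (Finset.mem_filter.1 (Finset.mem_coe.1 ha)).1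
      have hb' := Finset.mem_range.1 (Finset.mem_filter.1 (Finset.mem_coe.1 hb)).1
      exact hv a (by omega) b (by omega) hab
  have hB : B.card ≤ (S.erase (v 0)).card := by
    apply Finset.card_le_card_of_injOn (fun j => v (j + 1))
    · intro a ha
      have ha' := Finset.mem_range.1 (Finset.mem_filter.1 (Finset.mem_coe.1 ha)).1
      refine Finset.mem_erase.2 ⟨fun h => ?_, (Finset.mem_filter.1 ha).2⟩
      have := hv _ (by omega) _ (by omega) h
      omega
    · intro a ha b hb hab
      have ha' := Finset.mem_range.1 (Finset.mem_filter.1 (Finset.mem_coe.1 ha)).1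
      have hb' := Finset.mem_range.1 (Finset.mem_filter.1 (Finset.mem_coe.1 hb)).1
      have := hv _ (by omega) _ (by omega) hab
      omega
  rw [Finset.card_erase_of_mem hx] at hB
  have hSpos : 0 < S.card := Finset.card_pos.2 ⟨_, hx⟩
  let c : ℕ → ℕ := fun j => (if v j ∈ S then 1 else 0) + (if v (j + 1) ∈ S then 1 else 0)
  have hcsum : ∑ j ∈ Finset.range m, c j = A.card + B.card := by
    simp only [c, Finset.sum_add_distrib, Finset.card_filter, A, B]
  have hcJ : ∑ j ∈ J, c j ≤ ∑ j ∈ Finset.range m, c j :=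
    Finset.sum_le_sum_of_subset (Finset.filter_subset _ _)
  have hkey : ∀ j ∈ J, (e j ∩ S).card ≤ c j + 1 := by
    intro j hj
    have hjm := (Finset.mem_filter.1 hj).1
    have hjm' := Finset.mem_range.1 hjm
    have hej := hc (e j) (hE ▸ Finset.mem_image_of_mem e hjm)
    have hne : v j ≠ v (j + 1) := fun h => by have := hv _ (by omega) _ (by omega) h; omega
    have h1 : (((e j).erase (v j)).erase (v (j + 1))).card ≤ 1 := by
      rw [Finset.card_erase_of_mem (Finset.mem_erase.2 ⟨hne.symm, (hve j hjm').2⟩),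
        Finset.card_erase_of_mem (hve j hjm').1]
      omega
    have h2 : e j ∩ S ⊆ (({v j} : Finset V).filter (· ∈ S) ∪ ({v (j + 1)} : Finset V).filter (· ∈ S))
        ∪ ((e j).erase (v j)).erase (v (j + 1)) := by
      intro z hz
      rw [Finset.mem_inter] at hz
      simp only [Finset.mem_union, Finset.mem_filter, Finset.mem_singleton, Finset.mem_erase]
      tauto
    have h3 := Finset.card_le_card h2
    have h4 := Finset.card_union_le (({v j} : Finset V).filter (· ∈ S) ∪
      ({v (j + 1)} : Finset V).filter (· ∈ S)) (((e j).erase (v j)).erase (v (j + 1)))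
    have h5 := Finset.card_union_le (({v j} : Finset V).filter (· ∈ S))
      (({v (j + 1)} : Finset V).filter (· ∈ S))
    have h6 : (({v j} : Finset V).filter (· ∈ S)).card = if v j ∈ S then 1 else 0 := by
      rw [Finset.filter_singleton]; split_ifs <;> simp
    have h7 : (({v (j + 1)} : Finset V).filter (· ∈ S)).card = if v (j + 1) ∈ S then 1 else 0 := by
      rw [Finset.filter_singleton]; split_ifs <;> simp
    simp only [c]
    omega
  have hc1 : ∀ j ∈ J, 1 ≤ c j := by
    intro j hj
    have h1 := hkey j hj
    have h2 := (Finset.mem_filter.1 hj).2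
    omega
  constructor
  · rw [hEJ, Finset.card_image_of_injOn hJinj]
    have : J.card ≤ ∑ j ∈ J, c j := by
      rw [Finset.card_eq_sum_ones]
      exact Finset.sum_le_sum hc1
    omega
  · have h1 : ∑ z ∈ S, degE (E2 E S) z = ∑ f ∈ E2 E S, (f ∩ S).card := by
      unfold degE
      simp only [Finset.card_filter]
      rw [Finset.sum_comm]
      apply Finset.sum_congr rfl
      intro f _
      rw [← Finset.card_filter, Finset.inter_comm]
      congr 1
    rw [h1, hEJ, Finset.sum_image hJinj]
    have h2 : ∑ j ∈ J, (e j ∩ S).card ≤ ∑ j ∈ J, 2 * c j := by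
      apply Finset.sum_le_sum
      intro j hj
      have := hkey j hj
      have := hc1 j hj
      omega
    rw [← Finset.mul_sum] at h2
    omega

open Classical in
theorem degE_le_E2 {V : Type*} {W : Finset V} {m : ℕ} {E : Finset (Finset V)} {x y : V}
    (hP : Pth W m E x y) {S : Finset V} (hS : ∀ z, z ∈ S ↔ Pth W m E z y) :
    degE E x ≤ degE (E2 E S) x + 1 := by
  have hxS : x ∈ S := (hS x).2 hP
  obtain ⟨v, e, ⟨hv, he, hve⟩, rfl, rfl, hW, hE⟩ := hP
  have : E.filter (fun f => v 0 ∈ f) ⊆ insert (e 0) ((E2 E S).filter (fun f => v 0 ∈ f)) := by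
    intro f hf
    rw [Finset.mem_filter] at hf
    obtain ⟨hfE, h0⟩ := hf
    have hfE' := hfE
    rw [← hE] at hfE'
    obtain ⟨k, hk, rfl⟩ := Finset.mem_image.1 hfE'
    have hk' := Finset.mem_range.1 hk
    rw [Finset.mem_insert]
    by_cases hk0 : k = 0
    · left; rw [hk0]
    · right
      have h1 := IsBP.rot ⟨hv, he, hve⟩ hW hE hk' h0 (hve k hk').2 (Or.inl rfl)
      rw [Finset.insert_erase hfE] at h1
      have h2 : v k ∈ S := (hS _).2 h1
      simp only [E2, Finset.mem_filter]
      refine ⟨⟨hfE, ?_⟩, h0⟩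
      have h3 : ({v 0, v k} : Finset V) ⊆ e k ∩ S := by
        intro z hz
        rw [Finset.mem_insert, Finset.mem_singleton] at hz
        rcases hz with rfl | rfl
        · exact Finset.mem_inter.2 ⟨h0, hxS⟩
        · exact Finset.mem_inter.2 ⟨(hve k hk').1, h2⟩
      have h4 := Finset.card_le_card h3
      rwa [Finset.card_pair (fun h => hk0 (hv _ (by omega) _ (by omega) h).symm)] at h4
  have h1 := Finset.card_le_card this
  have h2 := Finset.card_insert_le (e 0) ((E2 E S).filter (fun f => v 0 ∈ f))
  unfold degE
  omega

open Classical in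
/-- The numerical part of the argument. -/
theorem numeric {V : Type*} [Fintype V] (R adj : V → V → Prop) (D : V → ℕ)
    (hsymm : ∀ x y, R x y → R y x) (hadj : ∀ x y, adj x y → adj y x)
    (ha : ∀ x y, R x y → D x ≤ 2 * (Finset.univ.filter (fun z => R z y)).card)
    (hb : ∀ x y, R x y → ∑ z ∈ Finset.univ.filter (fun z => R z y), D z ≤
      5 * (Finset.univ.filter (fun z => R z y)).card)
    (hc : ∀ y, ((Finset.univ.filter (fun z => R z y)).filter (fun z => adj z y)).card ≤ 2 * D y)
    (hd : ∀ x y, R x y → ¬ adj x y → 66 ≤ D x + D y)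
    (hpos : ∀ x y, R x y → 1 ≤ D x)
    {u v : V} (huv : R u v) (hn : ¬ adj u v) : False := by
  -- a general bound: if all members of `S y` have `D ≥ 1 + t`
  have gen : ∀ x y t, R x y → ¬ adj x y → (∀ z, R z y → 1 + t ≤ D z) →
      ∃ s b : ℕ, 1 ≤ s ∧ b ≤ 2 * D y ∧ s * (66 - D y) + b * (1 + t) ≤ 5 * (s + b) ∧
        66 - D y ≤ 2 * (s + b) := by
    intro x y t hxy hna ht
    set S := Finset.univ.filter (fun z => R z y) with hS
    set S1 := S.filter (fun z => adj z y)
    set S2 := S.filter (fun z => ¬ adj z y)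
    have hcard : S1.card + S2.card = S.card := Finset.card_filter_add_card_filter_not _
    have hsum : ∑ z ∈ S1, D z + ∑ z ∈ S2, D z = ∑ z ∈ S, D z :=
      Finset.sum_filter_add_sum_filter_not _ _ _
    have h1 : S1.card * (1 + t) ≤ ∑ z ∈ S1, D z := by
      rw [← smul_eq_mul]
      apply Finset.card_nsmul_le_sum
      intro z hz
      exact ht z (Finset.mem_filter.1 (Finset.mem_filter.1 hz).1).2
    have h2 : S2.card * (66 - D y) ≤ ∑ z ∈ S2, D z := by
      rw [← smul_eq_mul]
      apply Finset.card_nsmul_le_sum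
      intro z hz
      have hz' := Finset.mem_filter.1 hz
      have := hd z y (Finset.mem_filter.1 hz'.1).2 hz'.2
      omega
    have h3 : ∑ z ∈ S, D z ≤ 5 * S.card := hb x y hxy
    have h4 : D x ≤ 2 * S.card := ha x y hxy
    have h5 : S1.card ≤ 2 * D y := hc y
    have h6 := hd x y hxy hna
    refine ⟨S2.card, S1.card, ?_, h5, ?_, ?_⟩
    · exact Finset.card_pos.2 ⟨x, Finset.mem_filter.2
        ⟨Finset.mem_filter.2 ⟨Finset.mem_univ _, hxy⟩, hna⟩⟩
    · omega
    · omega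
  -- choose `y` with `D y` minimal in `S u`
  obtain ⟨y, hyS, hymin⟩ := Finset.exists_min_image (Finset.univ.filter (fun z => R z u)) D
    ⟨v, Finset.mem_filter.2 ⟨Finset.mem_univ _, hsymm _ _ huv⟩⟩
  have hyu : R y u := (Finset.mem_filter.1 hyS).2
  have hmin : ∀ z, R z u → D y ≤ D z := fun z hz =>
    hymin z (Finset.mem_filter.2 ⟨Finset.mem_univ _, hz⟩)
  have hy1 := hpos y u hyu
  have hy5 : D y ≤ 5 := by
    have h1 : (Finset.univ.filter (fun z => R z u)).card * D y ≤
        ∑ z ∈ Finset.univ.filter (fun z => R z u), D z := by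
      rw [← smul_eq_mul]
      exact Finset.card_nsmul_le_sum _ _ _ hymin
    have h2 := hb y u hyu
    have h3 : 0 < (Finset.univ.filter (fun z => R z u)).card := Finset.card_pos.2 ⟨y, hyS⟩
    by_contra hcon
    have : (Finset.univ.filter (fun z => R z u)).card * 6 ≤
      (Finset.univ.filter (fun z => R z u)).card * D y := Nat.mul_le_mul_left _ (by omega)
    omega
  by_cases hA : ∃ x, R x y ∧ ¬ adj x y
  · obtain ⟨x, hx, hxa⟩ := hA
    obtain ⟨s, b, hs, hb1, hb2, hb3⟩ := gen x y 0 hx hxa (fun z hz => by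
      have := hpos z y hz; omega)
    have : s * 61 ≤ s * (66 - D y) := Nat.mul_le_mul_left _ (by omega)
    omega
  · push Not at hA
    have h1 : (Finset.univ.filter (fun z => R z y)).card ≤ 2 * D y := by
      refine le_trans (Finset.card_le_card ?_) (hc y)
      intro z hz
      exact Finset.mem_filter.2 ⟨hz, hA z (Finset.mem_filter.1 hz).2⟩
    have h2 := ha u y (hsymm _ _ hyu)
    obtain ⟨s, b, hs, hb1, hb2, hb3⟩ := gen v u (D y - 1) (hsymm _ _ huv)
      (fun h => hn (hadj _ _ h)) (fun z hz => by have := hmin z hz; omega)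
    have h3 : D u ≤ 4 * D y := by omega
    have h4 : s * (66 - 4 * D y) ≤ s * (66 - D u) := Nat.mul_le_mul_left _ (by omega)
    generalize D y = t at *
    interval_cases t <;> omega

theorem ore_step {V : Type*} [Fintype V] {m : ℕ}
    {H E : Finset (Finset V)} {u v : V}
    (hP : Pth Finset.univ m E u v) (hc : ∀ f ∈ E, f.card ≤ 3) (hmpos : 0 < m)
    (hOre : ∀ u v : V, u ≠ v → ¬ HAdj H u v → m + 1 + 65 ≤ shadowDeg H u + shadowDeg H v)
    (hna : ¬ HAdj H u v) : Improves Finset.univ m H E := by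
  classical
  by_contra hcon
  have hne : ∀ x y, Pth Finset.univ m E x y → x ≠ y := by
    rintro x y ⟨v, e, ⟨hv, he, hve⟩, rfl, rfl, hW, hE⟩ h
    have := hv _ (by omega) _ (by omega) h
    omega
  have hHs : ∀ x y, HAdj H x y → HAdj H y x := by
    rintro x y ⟨h, f, hf, hx, hy⟩
    exact ⟨h.symm, f, hf, hy, hx⟩
  refine numeric (fun x y => Pth Finset.univ m E x y) (HAdj H) (degE E)
    (fun x y h => h.symm) hHs ?_ ?_ ?_ ?_ ?_ hP hna
  · intro x y hxy
    have h1 := degE_le_E2 hxy (S := Finset.univ.filter (fun z => Pth Finset.univ m E z y)) (by simp)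
    have h2 := (E2_bounds hxy hc
      (S := Finset.univ.filter (fun z => Pth Finset.univ m E z y)) (by simpa using hxy)).1
    have h3 : degE (E2 E (Finset.univ.filter (fun z => Pth Finset.univ m E z y))) x ≤
      (E2 E (Finset.univ.filter (fun z => Pth Finset.univ m E z y))).card :=
        Finset.card_filter_le _ _
    omega
  · intro x y hxy
    have h2 := (E2_bounds hxy hc
      (S := Finset.univ.filter (fun z => Pth Finset.univ m E z y)) (by simpa using hxy)).2
    have h1 : ∑ z ∈ Finset.univ.filter (fun z => Pth Finset.univ m E z y), degE E z ≤
        ∑ z ∈ Finset.univ.filter (fun z => Pth Finset.univ m E z y),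
          (degE (E2 E (Finset.univ.filter (fun z => Pth Finset.univ m E z y))) z + 1) := by
      apply Finset.sum_le_sum
      intro z hz
      exact degE_le_E2 (Finset.mem_filter.1 hz).2 (by simp)
    rw [Finset.sum_add_distrib, ← Finset.card_eq_sum_ones] at h1
    omega
  · intro y
    have hsub : ((Finset.univ.filter (fun z => Pth Finset.univ m E z y)).filter
        (fun z => HAdj H z y)) ⊆ (E.filter (fun f => y ∈ f)).biUnion (fun f => f.erase y) := by
      intro z hz
      rw [Finset.mem_filter, Finset.mem_filter] at hz
      obtain ⟨⟨_, hzy⟩, hadj⟩ := hz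
      obtain ⟨hne', f, hf, hzf, hyf⟩ := hadj
      rw [Finset.mem_biUnion]
      by_cases hfE : f ∈ E
      · exact ⟨f, Finset.mem_filter.2 ⟨hfE, hyf⟩, Finset.mem_erase.2 ⟨hne', hzf⟩⟩
      · exact absurd ⟨E, z, y, f, hzy, hfE, hzf, hyf, hf, fun g hg => Or.inl hg⟩ hcon
    have h1 := Finset.card_le_card hsub
    have h2 : ((E.filter (fun f => y ∈ f)).biUnion (fun f => f.erase y)).card ≤
        (E.filter (fun f => y ∈ f)).card * 2 := by
      apply Finset.card_biUnion_le_card_mul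
      intro f hf
      rw [Finset.mem_filter] at hf
      rw [Finset.card_erase_of_mem hf.2]
      have := hc f hf.1
      omega
    unfold degE
    omega
  · intro x y hxy hnadj
    by_contra hlt
    have := hOre x y (hne x y hxy) hnadj
    exact hcon (crossing hxy hc hnadj (hne x y hxy) (by omega))
  · rintro x y ⟨v, e, ⟨hv, he, hve⟩, rfl, rfl, hW, hE⟩
    apply Finset.card_pos.2
    exact ⟨e 0, Finset.mem_filter.2 ⟨hE ▸ Finset.mem_image_of_mem e (Finset.mem_range.2 hmpos),
      (hve 0 hmpos).1⟩⟩

/-! ### Eliminating the fake edges -/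

theorem partB {V : Type*} [Fintype V] {m : ℕ} (hmpos : 0 < m) {H H' : Finset (Finset V)}
    (hOre : ∀ u v : V, u ≠ v → ¬ HAdj H u v → m + 1 + 65 ≤ shadowDeg H u + shadowDeg H v)
    (hsub : H ⊆ H') (hcard : ∀ f ∈ H', f.card ≤ 3)
    (hfake : ∀ f ∈ H', f ∉ H → ∀ u ∈ f, ∀ v ∈ f, ¬ HAdj H u v) :
    ∀ (k : ℕ) (C : BergeCycle H' (m + 1)), Set.range C.vtx = Set.univ →
      (Set.range C.edge \ (H : Set (Finset V))).ncard = k → HamiltonianBergeCycle H := by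
  classical
  intro k
  induction k using Nat.strong_induction_on with
  | _ k ih =>
    intro C hC hk
    by_cases hall : ∀ i, C.edge i ∈ H
    · exact ⟨m + 1, ⟨C.vtx, C.edge, C.vtx_inj, C.edge_inj, hall, C.mem_fst, C.mem_snd⟩, hC⟩
    · push Not at hall
      obtain ⟨i, hi⟩ := hall
      obtain ⟨E, hP, hE⟩ := C.openAt (W := Finset.univ) (by simpa using hC) i
      have hEH' : ∀ f ∈ E, f ∈ H' := by
        intro f hf
        obtain ⟨_, j, rfl⟩ := (hE f).1 hf
        exact C.edge_mem j
      have hna := hfake _ (C.edge_mem i) hi _ (C.mem_snd i) _ (C.mem_fst i)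
      obtain ⟨E', x, y, h, hP', hh, hx, hy, hhH, hE'⟩ :=
        ore_step hP (fun f hf => hcard f (hEH' f hf)) hmpos hOre hna
      obtain ⟨C', hC', hCe⟩ := hP'.close hx hy hh (hsub hhH) (by
        intro f hf
        rcases hE' f hf with h1 | h1
        · exact hEH' f h1
        · exact hsub h1)
      refine ih _ ?_ C' (by simpa using hC') rfl
      rw [← hk, hCe]
      apply Set.ncard_lt_ncard
      · rw [Set.ssubset_iff_of_subset]
        · refine ⟨C.edge i, ⟨⟨i, rfl⟩, by simpa using hi⟩, ?_⟩
          rintro ⟨h1, h2⟩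
          rcases h1 with h1 | h1
          · exact h2 (h1 ▸ hhH)
          · rcases hE' _ h1 with h3 | h3
            · exact ((hE _).1 h3).1 rfl
            · exact h2 h3
        · rintro f ⟨h1, h2⟩
          refine ⟨?_, h2⟩
          rcases h1 with rfl | h1
          · exact absurd hhH h2
          · rcases hE' _ h1 with h3 | h3
            · exact ((hE _).1 h3).2
            · exact absurd h3 h2
      · exact (Set.finite_range _).subset Set.sdiff_subset

/-! ### The cyclic combinatorial contradiction -/

theorem comb_contra {R : Type*} [CommRing R] (n1 : (1 : R) ≠ 0) (n2 : (2 : R) ≠ 0) (n3 : (3 : R) ≠ 0)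
    (n4 : (4 : R) ≠ 0) (n5 : (5 : R) ≠ 0) (K : R → Prop) (T : R → R → Prop) (τ : R → R)
    (hT : ∀ l a, T l a → a = l ∨ a = l + 1 ∨ (¬ K l ∧ a = τ l))
    (A : ∀ j k, K j → K k → j ≠ k → ∃ l, T l j ∧ T l k)
    (A' : ∀ j k, K j → K k → j ≠ k → ∃ l, T l (j + 1) ∧ T l (k + 1))
    (B : ∀ i j, ¬ K i → ¬ K (i - 1) → K j → ∃ l, l ≠ i - 1 ∧ T l j ∧ T l (i - 1))
    (B' : ∀ i j, ¬ K i → ¬ K (i - 1) → K j → ∃ l, l ≠ i ∧ T l (j + 1) ∧ T l (i + 1))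
    (C : ∀ i, K i ∨ K (i + 1) ∨ K (i + 2) ∨ K (i + 3)) : False := by
  classical
  have A1 : ∀ j k, K j → K k → j ≠ k → k = j + 1 ∨ j = k + 1 ∨ (¬ K (j - 1) ∧ τ (j - 1) = k) ∨
      (¬ K (k - 1) ∧ τ (k - 1) = j) := by
    intro j k hj hk hjk
    obtain ⟨l, h1, h2⟩ := A j k hj hk hjk
    rcases hT _ _ h1 with rfl | rfl | ⟨h3, h4⟩
    · rcases hT _ _ h2 with rfl | rfl | ⟨h5, h6⟩
      · exact absurd rfl hjk
      · exact Or.inl rfl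
      · exact absurd hj h5
    · rcases hT _ _ h2 with rfl | rfl | ⟨h5, h6⟩
      · exact Or.inr (Or.inl rfl)
      · exact absurd rfl hjk
      · right; right; left; rw [add_sub_cancel_right]; exact ⟨h5, h6.symm⟩
    · rcases hT _ _ h2 with rfl | rfl | ⟨h5, h6⟩
      · exact absurd hk h3
      · right; right; right; rw [add_sub_cancel_right]; exact ⟨h3, h4.symm⟩
      · exact absurd (h4.trans h6.symm) hjk
  have A2 : ∀ j k, K j → K k → j ≠ k → k = j + 1 ∨ j = k + 1 ∨ (¬ K (j + 1) ∧ τ (j + 1) = k + 1) ∨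
      (¬ K (k + 1) ∧ τ (k + 1) = j + 1) := by
    intro j k hj hk hjk
    obtain ⟨l, h1, h2⟩ := A' j k hj hk hjk
    rcases hT _ _ h1 with h3 | h3 | ⟨h3, h4⟩
    · subst h3
      rcases hT _ _ h2 with h5 | h5 | ⟨h5, h6⟩
      · exact absurd (add_right_cancel h5).symm hjk
      · exact Or.inl (add_right_cancel h5)
      · exact Or.inr (Or.inr (Or.inl ⟨h5, h6.symm⟩))
    · have h3 := add_right_cancel h3
      subst h3
      rcases hT _ _ h2 with h5 | h5 | ⟨h5, h6⟩
      · exact Or.inr (Or.inl h5.symm)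
      · exact absurd (add_right_cancel h5).symm hjk
      · exact absurd hj h5
    · rcases hT _ _ h2 with h5 | h5 | ⟨h5, h6⟩
      · subst h5; exact Or.inr (Or.inr (Or.inr ⟨h3, h4.symm⟩))
      · have h5 := add_right_cancel h5
        subst h5; exact absurd hk h3
      · exact absurd (add_right_cancel (h4.trans h6.symm)) hjk
  have B1 : ∀ b j, K b → ¬ K (b + 1) → ¬ K (b + 2) → K j → j ≠ b →
      ¬ K (j - 1) ∧ τ (j - 1) = b + 1 := by
    intro b j hb hb1 hb2 hj hjb
    obtain ⟨l, h0, h1, h2⟩ := B (b + 2) j hb2 (by rwa [show b + 2 - 1 = b + 1 by ring]) hj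
    rw [show b + 2 - 1 = b + 1 by ring] at h0 h2
    rcases hT _ _ h2 with h3 | h3 | ⟨h3, h4⟩
    · exact absurd h3.symm h0
    · have h3 := add_right_cancel h3
      subst h3
      rcases hT _ _ h1 with h5 | h5 | ⟨h5, h6⟩
      · exact absurd h5 hjb
      · exact absurd (h5 ▸ hj) hb1
      · exact absurd hb h5
    · rcases hT _ _ h1 with h5 | h5 | ⟨h5, h6⟩
      · exact absurd (h5 ▸ hj) h3
      · subst h5; rw [add_sub_cancel_right]; exact ⟨h3, h4.symm⟩
      · exact absurd ((h6.trans h4.symm) ▸ hj) hb1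
  have B2 : ∀ a j, K a → ¬ K (a - 1) → ¬ K (a - 2) → K j → j ≠ a →
      ¬ K (j + 1) ∧ τ (j + 1) = a := by
    intro b j hb hb1 hb2 hj hjb
    obtain ⟨l, h0, h1, h2⟩ := B' (b - 1) j hb1 (by rwa [show b - 1 - 1 = b - 2 by ring]) hj
    rw [sub_add_cancel] at h2
    rcases hT _ _ h2 with h3 | h3 | ⟨h3, h4⟩
    · subst h3
      rcases hT _ _ h1 with h5 | h5 | ⟨h5, h6⟩
      · exact absurd (by rwa [← h5, add_sub_cancel_right]) hb1
      · exact absurd (add_right_cancel h5) hjb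
      · exact absurd hb h5
    · exact absurd (by rw [h3, add_sub_cancel_right]) h0
    · rcases hT _ _ h1 with h5 | h5 | ⟨h5, h6⟩
      · subst h5; exact ⟨h3, h4.symm⟩
      · have h5 := add_right_cancel h5
        subst h5; exact absurd hj h3
      · exact absurd (by rwa [h4, ← h6, add_sub_cancel_right]) hb1
  by_cases hZ : ∃ i, ¬ K i ∧ ¬ K (i + 1)
  · have hb : ∃ b, K b ∧ ¬ K (b + 1) ∧ ¬ K (b + 2) := by
      obtain ⟨i, hi, hi1⟩ := hZ
      by_cases h : K (i - 1)
      · exact ⟨i - 1, h, by simpa using hi, by rwa [show i - 1 + 2 = i + 1 by ring]⟩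
      · refine ⟨i - 2, ?_, by rwa [show i - 2 + 1 = i - 1 by ring], by simpa using hi⟩
        have := C (i - 2)
        rw [show i - 2 + 1 = i - 1 by ring, show i - 2 + 2 = i by ring,
          show i - 2 + 3 = i + 1 by ring] at this
        tauto
    obtain ⟨b, hb, hb1, hb2⟩ := hb
    have huniq : ∀ j k, K j → K k → j ≠ b → k ≠ b → j = k := by
      intro j k hj hk hjb hkb
      by_contra hjk
      obtain ⟨h1, h2⟩ := B1 b j hb hb1 hb2 hj hjb
      obtain ⟨h3, h4⟩ := B1 b k hb hb1 hb2 hk hkb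
      rcases A1 j k hj hk hjk with h | h | h | h
      · subst h; simp at h3; exact h3 hj
      · subst h; simp at h1; exact h1 hk
      · rw [h2] at h; exact hb1 (h.2 ▸ hk)
      · rw [h4] at h; exact hb1 (h.2 ▸ hj)
    have ha : ∃ a, K a ∧ ¬ K (a - 1) ∧ ¬ K (a - 2) ∧ (a = b + 3 ∨ a = b + 4) := by
      by_cases h : K (b + 3)
      · exact ⟨b + 3, h, by rwa [show b + 3 - 1 = b + 2 by ring],
          by rwa [show b + 3 - 2 = b + 1 by ring], Or.inl rfl⟩
      · refine ⟨b + 4, ?_, by rwa [show b + 4 - 1 = b + 3 by ring],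
          by rwa [show b + 4 - 2 = b + 2 by ring], Or.inr rfl⟩
        have := C (b + 1)
        rw [show b + 1 + 1 = b + 2 by ring, show b + 1 + 2 = b + 3 by ring,
          show b + 1 + 3 = b + 4 by ring] at this
        tauto
    obtain ⟨a, ha, ha1, ha2, hab⟩ := ha
    have hne : a ≠ b := by
      rintro rfl; rcases hab with h | h
      · exact n3 (by linear_combination -h)
      · exact n4 (by linear_combination -h)
    have hne1 : b ≠ a + 1 := by
      intro h0; rcases hab with h | h
      · exact n4 (by linear_combination -h - h0)
      · exact n5 (by linear_combination -h - h0)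
    have hne1' : a ≠ b + 1 := by
      rintro rfl; exact hb1 ha
    obtain ⟨f1, f2⟩ := B1 b a hb hb1 hb2 ha hne
    obtain ⟨f3, f4⟩ := B2 a b ha ha1 ha2 hb hne.symm
    have g1 : ¬ K (b - 1) ∧ τ (b - 1) = a := by
      rcases A1 a b ha hb hne with h | h | h | h
      · exact absurd h hne1
      · exact absurd h hne1'
      · exact absurd (f2.symm.trans h.2) (fun h => n1 (by linear_combination h))
      · exact h
    have g2 : ¬ K (a + 1) ∧ τ (a + 1) = b + 1 := by
      rcases A2 a b ha hb hne with h | h | h | h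
      · exact absurd h hne1
      · exact absurd h hne1'
      · exact h
      · exact absurd (h.2.symm.trans f4) (fun h => n1 (by linear_combination h))
    by_cases h : K (a + 2)
    · have h5 : a + 2 = b := by
        by_contra h5
        have := huniq _ _ h ha h5 hne
        exact n2 (by linear_combination this)
      rw [← h5, show a + 2 - 1 = a + 1 by ring] at g1
      exact hne1' (g1.2.symm.trans g2.2)
    · have := B1 a b ha g2.1 h hb hne.symm
      exact n1 (by linear_combination this.2.symm.trans g1.2)
  · push Not at hZ
    have four : ∀ a b c d, K a → K b → K c → K d → a ≠ b → a ≠ c → a ≠ d → b ≠ c → b ≠ d →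
        c ≠ d → False := by
      let φ : R → R := fun j => if K (j - 1) then j - 1 else τ (j - 1)
      have hφ : ∀ j k, K j → K k → j ≠ k → φ j = k ∨ φ k = j := by
        intro j k hj hk hjk
        rcases A1 j k hj hk hjk with h | h | h | h
        · right; subst h; simp [φ, hj]
        · left; subst h; simp [φ, hk]
        · left; simp [φ, h]
        · right; simp [φ, h]
      intro a b c d ha hb hc hd h1 h2 h3 h4 h5 h6
      have := hφ a b ha hb h1
      have := hφ a c ha hc h2
      have := hφ a d ha hd h3
      have := hφ b c hb hc h4
      have := hφ b d hb hd h5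
      have := hφ c d hc hd h6
      clear hφ A1 A2 B1 B2 A A' B B' C hT hZ
      clear_value φ
      grind
    have ne : ∀ (a p q : R), q - p ≠ 0 → a + p ≠ a + q := by
      intro a p q h h2; exact h (by linear_combination -h2)
    have hno : ∀ a, K a → ¬ K (a + 1) := by
      intro a ha ha1
      have e1 : K (a + 2) ∨ K (a + 3) := by
        have := hZ (a + 2); rw [show a + 2 + 1 = a + 3 by ring] at this; tauto
      have e2 : K (a + 4) ∨ K (a + 5) := by
        have := hZ (a + 4); rw [show a + 4 + 1 = a + 5 by ring] at this; tauto
      have ne0 : ∀ q : R, q ≠ 0 → a ≠ a + q := by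
        intro q h h2; exact h (by linear_combination -h2)
      have k1 : (3 - 1 : R) ≠ 0 := by norm_num; exact n2
      have k2 : (2 - 1 : R) ≠ 0 := by norm_num; exact n1
      have k3 : (4 - 1 : R) ≠ 0 := by norm_num; exact n3
      have k4 : (5 - 1 : R) ≠ 0 := by norm_num; exact n4
      have k5 : (4 - 2 : R) ≠ 0 := by norm_num; exact n2
      have k6 : (5 - 2 : R) ≠ 0 := by norm_num; exact n3
      have k7 : (4 - 3 : R) ≠ 0 := by norm_num; exact n1
      have k8 : (5 - 3 : R) ≠ 0 := by norm_num; exact n2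
      rcases e1 with e1 | e1 <;> rcases e2 with e2 | e2
      all_goals
        refine four _ _ _ _ ha ha1 e1 e2 (ne0 _ ?_) (ne0 _ ?_) (ne0 _ ?_) (ne _ _ _ ?_) (ne _ _ _ ?_)
          (ne _ _ _ ?_) <;> assumption
    have hstep : ∀ a, K a → K (a + 2) := by
      intro a ha
      have := hZ (a + 1) (hno a ha)
      rwa [show a + 1 + 1 = a + 2 by ring] at this
    have hKex : ∃ a, K a := by
      by_cases h : K 0
      · exact ⟨0, h⟩
      · exact ⟨_, hZ 0 h⟩
    obtain ⟨a, ha⟩ := hKex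
    have ha2 := hstep a ha
    have ha4 := hstep _ ha2
    have ha6 := hstep _ ha4
    rw [show a + 2 + 2 = a + 4 by ring] at ha4 ha6
    rw [show a + 4 + 2 = a + 6 by ring] at ha6
    have six : (6 : R) = 0 := by
      by_contra h6
      exact four _ _ _ _ ha ha2 ha4 ha6 (fun h => n2 (by linear_combination -h))
        (fun h => n4 (by linear_combination -h)) (fun h => h6 (by linear_combination -h))
        (fun h => n2 (by linear_combination -h)) (fun h => n4 (by linear_combination -h))
        (fun h => n2 (by linear_combination -h))
    have d02 : a ≠ a + 2 := fun h => n2 (by linear_combination -h)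
    have d04 : a ≠ a + 4 := fun h => n4 (by linear_combination -h)
    have d24 : a + 2 ≠ a + 4 := fun h => n2 (by linear_combination -h)
    have sep : ∀ j k, K j → K k → j ≠ k + 1 := by
      rintro j k hj hk rfl; exact hno k hk hj
    have p1 := A1 _ _ ha ha2 d02
    have p2 := A1 _ _ ha ha4 d04
    have p3 := A1 _ _ ha2 ha4 d24
    have q1 := A2 _ _ ha ha2 d02
    have q2 := A2 _ _ ha ha4 d04
    have q3 := A2 _ _ ha2 ha4 d24
    rw [show a + 2 - 1 = a + 1 by ring] at p1 p3
    rw [show a + 4 - 1 = a + 3 by ring] at p2 p3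
    rw [show a - 1 = a + 5 by linear_combination -six] at p1 p2
    rw [show a + 2 + 1 = a + 3 by ring] at q1 q3
    rw [show a + 4 + 1 = a + 5 by ring] at q2 q3
    have s1 := sep _ _ ha ha
    have s2 := sep _ _ ha ha2
    have s3 := sep _ _ ha ha4
    have s4 := sep _ _ ha2 ha
    have s5 := sep _ _ ha2 ha2
    have s6 := sep _ _ ha2 ha4
    have s7 := sep _ _ ha4 ha
    have s8 := sep _ _ ha4 ha2
    have s9 := sep _ _ ha4 ha4
    rw [show a + 2 + 1 = a + 3 by ring] at *
    rw [show a + 4 + 1 = a + 5 by ring] at *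
    clear A1 A2 B1 B2 A A' B B' C hT hZ sep hstep hno four ne
    generalize τ (a + 1) = t1 at *
    generalize τ (a + 3) = t3 at *
    generalize τ (a + 5) = t5 at *
    grind

/-! ### Adding a vertex to a cycle in a covering hypergraph -/

open Classical in
theorem BergeCycle.attach {V : Type*} {H : Finset (Finset V)} {m : ℕ} (C : BergeCycle H (m + 1))
    {W : Finset V} (hW : Set.range C.vtx = W) {x : V} (hxW : x ∉ W) (i : ZMod (m + 1))
    {h : Finset V} (hx : x ∈ h) (hi : C.vtx i ∈ h)
    (hh : h = C.edge (i - 1) ∨ ∀ k, C.edge k ≠ h) :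
    ∃ E : Finset (Finset V), (∀ f, f ∈ E ↔ f = h ∨ ∃ k, k ≠ i - 1 ∧ C.edge k = f) ∧
      Pth (insert x W) (m + 1) E x (C.vtx (i - 1)) ∧
      ∀ j, j ≠ i - 1 → x ∈ C.edge j → Pth (insert x W) (m + 1) E (C.vtx j) (C.vtx (i - 1)) := by
  have hinj : ∀ a ≤ m, ∀ b ≤ m, (i + (a : ZMod (m + 1))) = i + (b : ZMod (m + 1)) → a = b := by
    intro a ha b hb hab
    have h1 : (a : ZMod (m + 1)) = b := by simpa using hab
    have h2 := congrArg ZMod.val h1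
    rwa [ZMod.val_natCast_of_lt (by omega), ZMod.val_natCast_of_lt (by omega)] at h2
  have hm : i + (m : ZMod (m + 1)) = i - 1 := by
    have : ((m + 1 : ℕ) : ZMod (m + 1)) = 0 := ZMod.natCast_self _
    push_cast at this
    linear_combination this
  have hsurj : ∀ k : ZMod (m + 1), ∃ a ≤ m, i + (a : ZMod (m + 1)) = k := by
    intro k
    refine ⟨(k - i).val, Nat.lt_succ_iff.1 (ZMod.val_lt _), ?_⟩
    simp
  have hlt : ∀ a < m, i + (a : ZMod (m + 1)) ≠ i - 1 := by
    intro a ha hc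
    have := hinj a ha.le m le_rfl (hc.trans hm.symm)
    omega
  have hsurj' : ∀ k : ZMod (m + 1), k ≠ i - 1 → ∃ a < m, i + (a : ZMod (m + 1)) = k := by
    intro k hk
    obtain ⟨a, ha, rfl⟩ := hsurj k
    refine ⟨a, lt_of_le_of_ne ha ?_, rfl⟩
    rintro rfl
    exact hk hm
  have hne : ∀ k, k ≠ i - 1 → C.edge k ≠ h := by
    intro k hk hc
    rcases hh with hh | hh
    · exact hk (C.edge_inj (hc.trans hh))
    · exact hh k hc
  have hxv : ∀ k, C.vtx k ≠ x := by
    rintro k rfl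
    exact hxW (Finset.mem_coe.1 (hW ▸ ⟨k, rfl⟩))
  let v : ℕ → V := fun a => if a = 0 then x else C.vtx (i + ((a - 1 : ℕ) : ZMod (m + 1)))
  let e : ℕ → Finset V := fun a => if a = 0 then h else C.edge (i + ((a - 1 : ℕ) : ZMod (m + 1)))
  have hBP : IsBP (m + 1) v e := by
    refine ⟨?_, ?_, ?_⟩
    · intro a ha b hb hab
      simp only [v] at hab
      split_ifs at hab with h1 h2 h2
      · omega
      · exact absurd hab.symm (hxv _)
      · exact absurd hab (hxv _)
      · have := hinj _ (by omega) _ (by omega) (C.vtx_inj hab); omega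
    · intro a ha b hb hab
      simp only [e] at hab
      split_ifs at hab with h1 h2 h2
      · omega
      · exact absurd hab.symm (hne _ (hlt _ (by omega)))
      · exact absurd hab (hne _ (hlt _ (by omega)))
      · have := hinj _ (by omega) _ (by omega) (C.edge_inj hab); omega
    · intro a ha
      rcases a with _ | a
      · simp [v, e, hx, hi]
      · simp only [v, e, Nat.add_sub_cancel, if_neg (Nat.succ_ne_zero _)]
        refine ⟨C.mem_fst _, ?_⟩
        have := C.mem_snd (i + (a : ZMod (m + 1)))
        push_cast
        rwa [← add_assoc]
  have hWv : (Finset.range (m + 1 + 1)).image v = insert x W := by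
    ext z
    rw [Finset.mem_insert, ← Finset.mem_coe (s := W), ← hW]
    simp only [Finset.mem_image, Finset.mem_range, Set.mem_range]
    constructor
    · rintro ⟨a, ha, rfl⟩
      by_cases h1 : a = 0
      · left; simp [v, h1]
      · right; exact ⟨_, by simp only [v, if_neg h1]; rfl⟩
    · rintro (rfl | ⟨k, rfl⟩)
      · exact ⟨0, by omega, by simp [v]⟩
      · obtain ⟨a, ha, rfl⟩ := hsurj k
        exact ⟨a + 1, by omega, by simp [v]⟩
  refine ⟨(Finset.range (m + 1)).image e, ?_, ⟨v, e, hBP, by simp [v], by simp [v, hm], hWv, rfl⟩, ?_⟩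
  · intro f
    simp only [Finset.mem_image, Finset.mem_range]
    constructor
    · rintro ⟨a, ha, rfl⟩
      by_cases h1 : a = 0
      · left; simp [e, h1]
      · right
        exact ⟨_, hlt (a - 1) (by omega), by simp [e, h1]⟩
    · rintro (rfl | ⟨k, hk, rfl⟩)
      · exact ⟨0, by omega, by simp [e]⟩
      · obtain ⟨a, ha, rfl⟩ := hsurj' k hk
        exact ⟨a + 1, by omega, by simp [e]⟩
  · intro j hj hxj
    obtain ⟨a, ha, rfl⟩ := hsurj' j hj
    have h1 := hBP.rot hWv rfl (j := a + 1) (by omega) (h := e (a + 1))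
      (by simpa [v, e] using hxj) (hBP.2.2 (a + 1) (by omega)).2 (Or.inl rfl)
    rw [Finset.insert_erase (Finset.mem_image_of_mem e (Finset.mem_range.2 (by omega)))] at h1
    simpa [v, hm] using h1

/-- The reversed cycle. -/
def BergeCycle.rev {V : Type*} {H : Finset (Finset V)} {t : ℕ} (C : BergeCycle H t) :
    BergeCycle H t where
  vtx i := C.vtx (-i)
  edge i := C.edge (-i - 1)
  vtx_inj a b h := neg_injective (C.vtx_inj h)
  edge_inj a b h := by
    have := C.edge_inj h
    exact neg_injective (sub_left_injective this)
  edge_mem i := C.edge_mem _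
  mem_fst i := by
    have := C.mem_snd (-i - 1)
    rwa [sub_add_cancel] at this
  mem_snd i := by
    have := C.mem_fst (-i - 1)
    rwa [show -(i + 1) = -i - 1 by ring]

theorem four_card {V : Type*} {f : Finset V} (hf : f.card ≤ 3) {a b c d : V}
    (ha : a ∈ f) (hb : b ∈ f) (hc : c ∈ f) (hd : d ∈ f) (h1 : a ≠ b) (h2 : a ≠ c) (h3 : a ≠ d)
    (h4 : b ≠ c) (h5 : b ≠ d) (h6 : c ≠ d) : False := by
  classical
  have : ({a, b, c, d} : Finset V) ⊆ f := by
    intro z hz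
    simp only [Finset.mem_insert, Finset.mem_singleton] at hz
    rcases hz with rfl | rfl | rfl | rfl <;> assumption
  have h := Finset.card_le_card this
  rw [Finset.card_insert_of_notMem (by simp [*]), Finset.card_insert_of_notMem (by simp [*]),
    Finset.card_insert_of_notMem (by simp [*]), Finset.card_singleton] at h
  omega

open Classical in
theorem cover_aux {V : Type*} {H : Finset (Finset V)} {m : ℕ} 
    (hcov : ∀ u v : V, u ≠ v → ∃ f ∈ H, u ∈ f ∧ v ∈ f) (C : BergeCycle H (m + 1))
    {W : Finset V} (hW : Set.range C.vtx = W) {x : V} (hxW : x ∉ W)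
    (hno : ¬ ∃ C' : BergeCycle H (m + 2), Set.range C'.vtx = insert x (W : Set V))
    {i : ZMod (m + 1)} {h : Finset V} (hH : h ∈ H) (hx : x ∈ h) (hi : C.vtx i ∈ h)
    (hh : h = C.edge (i - 1) ∨ ∀ k, C.edge k ≠ h) :
    (∀ f ∈ H, x ∈ f → C.vtx (i - 1) ∈ f → f = h ∨ ∃ k, k ≠ i - 1 ∧ C.edge k = f) ∧
    ∀ j, j ≠ i - 1 → x ∈ C.edge j →
      ∃ f, C.vtx j ∈ f ∧ C.vtx (i - 1) ∈ f ∧ (f = h ∨ ∃ k, k ≠ i - 1 ∧ C.edge k = f) := by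
  obtain ⟨E, hE, hP, hQ⟩ := C.attach hW hxW i hx hi hh
  have hEH : E ⊆ H := by
    intro f hf
    rcases (hE f).1 hf with rfl | ⟨k, _, rfl⟩
    · exact hH
    · exact C.edge_mem k
  constructor
  · intro f hf hxf hif
    by_contra hcon
    obtain ⟨C', hC', _⟩ := hP.close hxf hif (fun h => hcon ((hE f).1 h)) hf hEH
    exact hno ⟨C', by simpa using hC'⟩
  · intro j hj hxj
    obtain ⟨f, hf, hjf, hif⟩ := hcov (C.vtx j) (C.vtx (i - 1)) (fun h => hj (C.vtx_inj h))
    refine ⟨f, hjf, hif, ?_⟩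
    by_contra hcon
    obtain ⟨C', hC', _⟩ := (hQ j hj hxj).close hjf hif (fun h => hcon ((hE f).1 h)) hf hEH
    exact hno ⟨C', by simpa using hC'⟩

theorem cover_step {V : Type*} {H : Finset (Finset V)} {m : ℕ} (hm : 5 ≤ m)
    (hc : ∀ f ∈ H, f.card ≤ 3)
    (hcov : ∀ u v : V, u ≠ v → ∃ f ∈ H, u ∈ f ∧ v ∈ f) (C : BergeCycle H (m + 1))
    {W : Finset V} (hW : Set.range C.vtx = W) {x : V} (hxW : x ∉ W) :
    ∃ C' : BergeCycle H (m + 2), Set.range C'.vtx = insert x (W : Set V) := by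
  classical
  by_contra hno
  have hxv : ∀ k, C.vtx k ≠ x := by
    rintro k rfl
    exact hxW (Finset.mem_coe.1 (hW ▸ ⟨k, rfl⟩))
  have nz : ∀ c : ℕ, 0 < c → c ≤ m → (c : ZMod (m + 1)) ≠ 0 := by
    intro c h1 h2 h3
    rw [ZMod.natCast_eq_zero_iff] at h3
    have := Nat.le_of_dvd h1 h3
    omega
  have n1 : (1 : ZMod (m + 1)) ≠ 0 := by exact_mod_cast nz 1 (by omega) (by omega)
  have n2 : (2 : ZMod (m + 1)) ≠ 0 := by exact_mod_cast nz 2 (by omega) (by omega)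
  have n3 : (3 : ZMod (m + 1)) ≠ 0 := by exact_mod_cast nz 3 (by omega) (by omega)
  have n4 : (4 : ZMod (m + 1)) ≠ 0 := by exact_mod_cast nz 4 (by omega) (by omega)
  have n5 : (5 : ZMod (m + 1)) ≠ 0 := by exact_mod_cast nz 5 (by omega) (by omega)
  have succ_ne : ∀ l : ZMod (m + 1), l ≠ l + 1 := fun l h => n1 (by linear_combination -h)
  have vne : ∀ {a b}, a ≠ b → C.vtx a ≠ C.vtx b := fun h1 h2 => h1 (C.vtx_inj h2)
  have hWrev : Set.range C.rev.vtx = W := by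
    rw [← hW]
    ext z
    constructor
    · rintro ⟨i, rfl⟩; exact ⟨-i, rfl⟩
    · rintro ⟨i, rfl⟩; exact ⟨-i, by simp [BergeCycle.rev]⟩
  -- the two versions of the exchange
  have X1 := fun {i} {h} => @cover_aux V H m hcov C W hW x hxW hno i h
  have X2 : ∀ {i h}, h ∈ H → x ∈ h → C.vtx i ∈ h → (h = C.edge i ∨ ∀ k, C.edge k ≠ h) →
      ∀ j, j ≠ i → x ∈ C.edge j →
      ∃ f, C.vtx (j + 1) ∈ f ∧ C.vtx (i + 1) ∈ f ∧ (f = h ∨ ∃ k, k ≠ i ∧ C.edge k = f) := by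
    intro i h hH hx hi hh j hj hxj
    have := (@cover_aux V H m hcov C.rev W hWrev x hxW hno (-i) h hH hx
      (by simpa [BergeCycle.rev] using hi)
      (by
        rcases hh with hh | hh
        · left; simpa [BergeCycle.rev] using hh
        · right; intro k; exact hh _)).2 (-j - 1)
      (by intro h; exact hj (by linear_combination -h))
      (by simpa [BergeCycle.rev] using hxj)
    obtain ⟨f, h1, h2, h3⟩ := this
    refine ⟨f, ?_, ?_, ?_⟩
    · simpa [BergeCycle.rev, add_comm] using h1
    · simpa [BergeCycle.rev, add_comm] using h2
    · rcases h3 with h3 | ⟨k, hk, rfl⟩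
      · exact Or.inl h3
      · exact Or.inr ⟨-k - 1, fun h => hk (by linear_combination -h), rfl⟩
  -- structure of edges
  let τ : ZMod (m + 1) → ZMod (m + 1) := fun l =>
    if h : ∃ a, a ≠ l ∧ a ≠ l + 1 ∧ C.vtx a ∈ C.edge l then h.choose else l
  have hT : ∀ l a, C.vtx a ∈ C.edge l → a = l ∨ a = l + 1 ∨ (¬ x ∈ C.edge l ∧ a = τ l) := by
    intro l a hal
    by_contra hcon
    push Not at hcon
    obtain ⟨h1, h2, h3⟩ := hcon
    by_cases hx : x ∈ C.edge l
    · exact four_card (hc _ (C.edge_mem l)) hx hal (C.mem_fst l) (C.mem_snd l) (hxv _).symm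
        (hxv _).symm (hxv _).symm (vne h1) (vne h2) (vne (succ_ne l))
    · have hex : ∃ a, a ≠ l ∧ a ≠ l + 1 ∧ C.vtx a ∈ C.edge l := ⟨a, h1, h2, hal⟩
      have h4 : τ l = hex.choose := dif_pos hex
      have h5 := hex.choose_spec
      rw [← h4] at h5
      exact four_card (hc _ (C.edge_mem l)) h5.2.2 hal (C.mem_fst l) (C.mem_snd l)
        (vne (h3 hx).symm) (vne h5.1) (vne h5.2.1) (vne h1) (vne h2) (vne (succ_ne l))
  -- free edges
  have hfree : ∀ i, ¬ x ∈ C.edge i → ¬ x ∈ C.edge (i - 1) →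
      ∃ h ∈ H, x ∈ h ∧ C.vtx i ∈ h ∧ ∀ k, C.edge k ≠ h := by
    intro i h1 h2
    obtain ⟨h, hH, hx, hi⟩ := hcov x (C.vtx i) (hxv i).symm
    refine ⟨h, hH, hx, hi, ?_⟩
    rintro k rfl
    rcases hT k i hi with rfl | rfl | h3
    · exact h1 hx
    · rw [add_sub_cancel_right] at h2; exact h2 hx
    · exact h3.1 hx
  refine comb_contra n1 n2 n3 n4 n5 (fun l => x ∈ C.edge l) (fun l a => C.vtx a ∈ C.edge l) τ hT
    ?_ ?_ ?_ ?_ ?_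
  · intro j k hj hk hjk
    obtain ⟨f, h1, h2, h3⟩ := (X1 (i := k + 1) (C.edge_mem k) hk (C.mem_snd k)
      (Or.inl (by rw [add_sub_cancel_right]))).2 j (by rwa [add_sub_cancel_right]) hj
    rw [add_sub_cancel_right] at h2
    rcases h3 with rfl | ⟨l, _, rfl⟩
    · exact ⟨k, h1, h2⟩
    · exact ⟨l, h1, h2⟩
  · intro j k hj hk hjk
    obtain ⟨f, h1, h2, h3⟩ := X2 (C.edge_mem k) hk (C.mem_fst k) (Or.inl rfl) j hjk hj
    rcases h3 with rfl | ⟨l, _, rfl⟩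
    · exact ⟨k, h1, h2⟩
    · exact ⟨l, h1, h2⟩
  · intro i j hi hi1 hj
    obtain ⟨h, hH, hx, hih, hfr⟩ := hfree i hi hi1
    have hji1 : j ≠ i - 1 := by rintro rfl; exact hi1 hj
    have hji : j ≠ i := by rintro rfl; exact hi hj
    obtain ⟨f, h1, h2, h3⟩ := (X1 hH hx hih (Or.inr hfr)).2 j hji1 hj
    rcases h3 with rfl | ⟨l, hl, rfl⟩
    · exact (four_card (hc _ hH) hx hih h1 h2 (hxv _).symm (hxv _).symm (hxv _).symm (vne hji.symm)
        (vne (fun h => n1 (by linear_combination h))) (vne hji1)).elim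
    · exact ⟨l, hl, h1, h2⟩
  · intro i j hi hi1 hj
    obtain ⟨h, hH, hx, hih, hfr⟩ := hfree i hi hi1
    have hji1 : j + 1 ≠ i := by rintro rfl; rw [add_sub_cancel_right] at hi1; exact hi1 hj
    have hji : j ≠ i := by rintro rfl; exact hi hj
    obtain ⟨f, h1, h2, h3⟩ := X2 hH hx hih (Or.inr hfr) j hji hj
    rcases h3 with rfl | ⟨l, hl, rfl⟩
    · exact (four_card (hc _ hH) hx hih h1 h2 (hxv _).symm (hxv _).symm (hxv _).symm (vne hji1.symm)
        (vne (succ_ne i)) (vne (fun h => hji (add_right_cancel h)))).elim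
    · exact ⟨l, hl, h1, h2⟩
  · intro i
    by_contra hcon
    push Not at hcon
    obtain ⟨k0, k1, k2, k3⟩ := hcon
    have e21 : i + 2 - 1 = i + 1 := by ring
    have e32 : i + 3 - 1 = i + 2 := by ring
    obtain ⟨h1, hH1, hx1, hi1, hf1⟩ := hfree (i + 1) k1 (by rwa [add_sub_cancel_right])
    obtain ⟨h2, hH2, hx2, hi2, hf2⟩ := hfree (i + 2) k2 (by rwa [e21])
    obtain ⟨h3, hH3, hx3, hi3, hf3⟩ := hfree (i + 3) k3 (by rwa [e32])
    have E12 : h1 = h2 := by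
      rcases (X1 hH2 hx2 hi2 (Or.inr hf2)).1 h1 hH1 hx1 (by rwa [e21]) with h | ⟨k, _, h⟩
      · exact h
      · exact absurd h (hf1 k)
    have E23 : h2 = h3 := by
      rcases (X1 hH3 hx3 hi3 (Or.inr hf3)).1 h2 hH2 hx2 (by rwa [e32]) with h | ⟨k, _, h⟩
      · exact h
      · exact absurd h (hf2 k)
    subst E12 E23
    exact four_card (hc _ hH1) hx1 hi1 hi2 hi3 (hxv _).symm (hxv _).symm (hxv _).symm
      (vne (fun h => n1 (by linear_combination -h))) (vne (fun h => n2 (by linear_combination -h)))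
      (vne (fun h => n1 (by linear_combination -h)))

/-! ### Covering hypergraphs are Hamiltonian -/

theorem key_div_mod {a b : ℕ} (ha : a < 6) (hb : b < 6) :
    (SixSearch.key a b / 6 = a ∧ SixSearch.key a b % 6 = b) ∨
    (SixSearch.key a b / 6 = b ∧ SixSearch.key a b % 6 = a) := by
  unfold SixSearch.key
  split_ifs <;> omega

theorem key_comm (a b : ℕ) : SixSearch.key a b = SixSearch.key b a := by
  unfold SixSearch.key
  split_ifs <;> omega

theorem cover_base {V : Type*} {H : Finset (Finset V)} (hc : ∀ f ∈ H, f.card ≤ 3)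
    (hcov : ∀ u v : V, u ≠ v → ∃ f ∈ H, u ∈ f ∧ v ∈ f) {W : Finset V} (hW : W.card = 6) :
    ∃ C : BergeCycle H 6, Set.range C.vtx = W := by
  classical
  obtain ⟨w, hwinj, hwW⟩ : ∃ w : ℕ → V, (∀ a < 6, ∀ b < 6, w a = w b → a = b) ∧ ∀ a, w a ∈ W := by
    let e := Finset.equivFinOfCardEq hW
    refine ⟨fun a => (e.symm (Fin.ofNat 6 a) : V), ?_, fun a => (e.symm _).2⟩
    intro a ha b hb hab
    have h1 := e.symm.injective (Subtype.ext hab)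
    have h2 := congrArg Fin.val h1
    simp only [Fin.ofNat] at h2
    omega
  have hFex : ∀ p : ℕ, ∃ f : Finset V, p / 6 < 6 → p % 6 < 6 → p / 6 ≠ p % 6 →
      f ∈ H ∧ w (p / 6) ∈ f ∧ w (p % 6) ∈ f := by
    intro p
    by_cases h : p / 6 < 6 ∧ p % 6 < 6 ∧ p / 6 ≠ p % 6
    · obtain ⟨f, hf, h1, h2⟩ := hcov (w (p / 6)) (w (p % 6))
        (fun h' => h.2.2 (hwinj _ h.1 _ h.2.1 h'))
      exact ⟨f, fun _ _ _ => ⟨hf, h1, h2⟩⟩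
    · exact ⟨∅, fun h1 h2 h3 => absurd ⟨h1, h2, h3⟩ h⟩
  choose F hF using hFex
  have hK : ∀ a < 6, ∀ b < 6, a ≠ b → F (SixSearch.key a b) ∈ H ∧
      w a ∈ F (SixSearch.key a b) ∧ w b ∈ F (SixSearch.key a b) := by
    intro a ha b hb hab
    have h := hF (SixSearch.key a b)
    rcases key_div_mod ha hb with ⟨h1, h2⟩ | ⟨h1, h2⟩
    · rw [h1, h2] at h
      exact h ha hb hab
    · rw [h1, h2] at h
      have := h hb ha hab.symm
      exact ⟨this.1, this.2.2, this.2.1⟩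
  let τ : ℕ → ℕ := fun p =>
    if h : ∃ c, c < 6 ∧ c ≠ p / 6 ∧ c ≠ p % 6 ∧ w c ∈ F p then h.choose else 6
  have hτspec : ∀ p, (τ p < 6 ∧ τ p ≠ p / 6 ∧ τ p ≠ p % 6 ∧ w (τ p) ∈ F p) ∨
      (τ p = 6 ∧ ¬ ∃ c, c < 6 ∧ c ≠ p / 6 ∧ c ≠ p % 6 ∧ w c ∈ F p) := by
    intro p
    by_cases h : ∃ c, c < 6 ∧ c ≠ p / 6 ∧ c ≠ p % 6 ∧ w c ∈ F p
    · left
      have h1 : τ p = h.choose := dif_pos h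
      rw [h1]
      exact h.choose_spec
    · exact Or.inr ⟨dif_neg h, h⟩
  have wne : ∀ {a b}, a < 6 → b < 6 → a ≠ b → w a ≠ w b := fun ha hb h1 h2 => h1 (hwinj _ ha _ hb h2)
  have hτ : ∀ a b c, a < 6 → b < 6 → c < 6 → a ≠ b → c ≠ a → c ≠ b →
      w c ∈ F (SixSearch.key a b) → τ (SixSearch.key a b) = c := by
    intro a b c ha hb hc6 hab hca hcb hw
    have hk := hK a ha b hb hab
    rcases hτspec (SixSearch.key a b) with ⟨h1, h2, h3, h4⟩ | ⟨_, h2⟩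
    · by_contra hne
      have h5 : τ (SixSearch.key a b) ≠ a ∧ τ (SixSearch.key a b) ≠ b := by
        rcases key_div_mod ha hb with ⟨g1, g2⟩ | ⟨g1, g2⟩
        · rw [g1] at h2; rw [g2] at h3; exact ⟨h2, h3⟩
        · rw [g1] at h2; rw [g2] at h3; exact ⟨h3, h2⟩
      exact four_card (hc _ hk.1) h4 hw hk.2.1 hk.2.2 (wne h1 hc6 hne) (wne h1 ha h5.1)
        (wne h1 hb h5.2) (wne hc6 ha hca) (wne hc6 hb hcb) (wne ha hb hab)
    · refine absurd ⟨c, hc6, ?_, ?_, hw⟩ h2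
      · rcases key_div_mod ha hb with ⟨g1, g2⟩ | ⟨g1, g2⟩ <;> rw [g1] <;> assumption
      · rcases key_div_mod ha hb with ⟨g1, g2⟩ | ⟨g1, g2⟩ <;> rw [g2] <;> assumption
  obtain ⟨p, q, r, s, t, u, ⟨hnd, hlt⟩, hgood⟩ := SixSearch.exists_good τ
    (by
      intro p
      rcases hτspec p with ⟨h, _⟩ | ⟨h, _⟩ <;> omega)
    (by
      intro p hp
      rcases hτspec p with ⟨_, h1, h2, _⟩ | ⟨h, _⟩
      · exact ⟨h1, h2⟩
      · rw [h]
        have hord : ∀ q ∈ SixSearch.order, q < 36 := by decide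
        have := hord p hp
        omega)
  let L : Fin 6 → ℕ := ![p, q, r, s, t, u]
  have hLlt : ∀ i, L i < 6 := by
    intro i
    fin_cases i <;> simp only [L] <;> apply hlt <;> simp
  have hLinj : Function.Injective L := by
    have : (List.ofFn L).Nodup := by simpa [L, List.ofFn_succ] using hnd
    exact List.nodup_ofFn.1 this
  have hLch : ∀ i : Fin 6, SixSearch.ch τ (L i) (L (i + 1)) (L (i + 1 + 1)) := by
    obtain ⟨g1, g2, g3, g4, g5, g6⟩ := hgood
    intro i
    fin_cases i
    · exact g1
    · exact g2
    · exact g3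
    · exact g4
    · exact g5
    · exact g6
  have hLne : ∀ {i j}, i ≠ j → L i ≠ L j := fun h1 h2 => h1 (hLinj h2)
  have s1 : ∀ i : Fin 6, i ≠ i + 1 := by decide
  have s2 : ∀ i : Fin 6, i ≠ i + 1 + 1 := by decide
  have hadjne : ∀ i : Fin 6, F (SixSearch.key (L i) (L (i + 1))) ≠
      F (SixSearch.key (L (i + 1)) (L (i + 1 + 1))) := by
    intro i heq
    have k1 := hK _ (hLlt i) _ (hLlt (i + 1)) (hLne (s1 i))
    have k2 := hK _ (hLlt (i + 1)) _ (hLlt (i + 1 + 1)) (hLne (s1 (i + 1)))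
    rcases hLch i with h | h
    · exact h (hτ _ _ _ (hLlt _) (hLlt _) (hLlt _) (hLne (s1 i)) (hLne (s2 i).symm)
        (hLne (s1 (i + 1)).symm) (heq ▸ k2.2.2))
    · exact h (hτ _ _ _ (hLlt _) (hLlt _) (hLlt _) (hLne (s1 (i + 1))) (hLne (s1 i))
        (hLne (s2 i)) (heq ▸ k1.2.1))
  have hedge : ∀ i j : Fin 6, F (SixSearch.key (L i) (L (i + 1))) =
      F (SixSearch.key (L j) (L (j + 1))) → i = j := by
    intro i j heq
    by_contra hij
    by_cases h1 : j = i + 1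
    · subst h1; exact hadjne i heq
    by_cases h2 : i = j + 1
    · subst h2; exact hadjne j heq.symm
    have k1 := hK _ (hLlt i) _ (hLlt (i + 1)) (hLne (s1 i))
    have k2 := hK _ (hLlt j) _ (hLlt (j + 1)) (hLne (s1 j))
    rw [← heq] at k2
    exact four_card (hc _ k1.1) k1.2.1 k1.2.2 k2.2.1 k2.2.2
      (wne (hLlt _) (hLlt _) (hLne (s1 i))) (wne (hLlt _) (hLlt _) (hLne hij))
      (wne (hLlt _) (hLlt _) (hLne h2)) (wne (hLlt _) (hLlt _) (hLne (Ne.symm h1)))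
      (wne (hLlt _) (hLlt _) (hLne (fun h => hij (add_right_cancel h))))
      (wne (hLlt _) (hLlt _) (hLne (s1 j)))
  have hvinj : ∀ i j : Fin 6, w (L i) = w (L j) → i = j := fun i j h =>
    hLinj (hwinj _ (hLlt i) _ (hLlt j) h)
  have hrange : Set.range (fun i : Fin 6 => w (L i)) = W := by
    have h1 : Finset.univ.image (fun i : Fin 6 => w (L i)) = W := by
      apply Finset.eq_of_subset_of_card_le
      · intro z hz
        obtain ⟨i, _, rfl⟩ := Finset.mem_image.1 hz
        exact hwW _
      · rw [hW, Finset.card_image_of_injective _ hvinj]; simp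
    rw [← h1]; simp
  have hmem := fun i : Fin 6 => hK _ (hLlt i) _ (hLlt (i + 1)) (hLne (s1 i))
  exact ⟨⟨fun i : Fin 6 => w (L i), fun i : Fin 6 => F (SixSearch.key (L i) (L (i + 1))),
    hvinj, hedge, fun i => (hmem i).1, fun i => (hmem i).2.1, fun i => (hmem i).2.2⟩, hrange⟩

theorem cover_ham {V : Type*} {H : Finset (Finset V)} (hc : ∀ f ∈ H, f.card ≤ 3)
    (hcov : ∀ u v : V, u ≠ v → ∃ f ∈ H, u ∈ f ∧ v ∈ f) (k : ℕ) :
    ∀ W : Finset V, W.card = k + 6 → ∃ C : BergeCycle H (k + 6), Set.range C.vtx = W := by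
  classical
  induction k with
  | zero => intro W hW; exact cover_base hc hcov hW
  | succ k ih =>
    intro W hW
    obtain ⟨x, hx⟩ : W.Nonempty := Finset.card_pos.1 (by omega)
    obtain ⟨C, hC⟩ := ih (W.erase x) (by rw [Finset.card_erase_of_mem hx]; omega)
    obtain ⟨C', hC'⟩ := cover_step (m := k + 5) (by omega) hc hcov C hC (Finset.notMem_erase x W)
    have h1 : insert x ((W.erase x : Finset V) : Set V) = W := by
      rw [← Finset.coe_insert, Finset.insert_erase hx]
    rw [h1] at hC'
    rw [show k + 1 + 6 = k + 5 + 2 by ring]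
    exact ⟨C', hC'⟩

/-- Ore-type theorem for `[3]`-graphs with `d₀ = 65`. -/
theorem stmt0 {V : Type*} [Fintype V] (n : ℕ) (hn : 6 ≤ n)
    (hcard : Fintype.card V = n) (H : Finset (Finset V)) (h3 : IsThreeGraph H)
    (hOre : ∀ u v : V, u ≠ v → ¬ HAdj H u v →
      n + 65 ≤ shadowDeg H u + shadowDeg H v) :
    HamiltonianBergeCycle H := by
  classical
  obtain ⟨k, rfl⟩ : ∃ k, n = k + 6 := ⟨n - 6, by omega⟩
  let H' : Finset (Finset V) := H ∪ Finset.univ.filter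
    (fun f => f.card ≤ 3 ∧ ∀ u ∈ f, ∀ v ∈ f, ¬ HAdj H u v)
  have hc : ∀ f ∈ H', f.card ≤ 3 := by
    intro f hf
    rcases Finset.mem_union.1 hf with h | h
    · rcases h3 f h with h | h <;> omega
    · exact (Finset.mem_filter.1 h).2.1
  have hcov : ∀ u v : V, u ≠ v → ∃ f ∈ H', u ∈ f ∧ v ∈ f := by
    intro u v huv
    by_cases h : HAdj H u v
    · obtain ⟨_, f, hf, hu, hv⟩ := h
      exact ⟨f, Finset.mem_union_left _ hf, hu, hv⟩
    · refine ⟨{u, v}, Finset.mem_union_right _ (Finset.mem_filter.2 ⟨Finset.mem_univ _, ?_, ?_⟩),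
        by simp, by simp⟩
      · rw [Finset.card_pair huv]; omega
      · intro a ha b hb hab
        obtain ⟨hne, f, hf, h1, h2⟩ := hab
        simp only [Finset.mem_insert, Finset.mem_singleton] at ha hb
        rcases ha with rfl | rfl <;> rcases hb with rfl | rfl
        · exact hne rfl
        · exact h ⟨huv, f, hf, h1, h2⟩
        · exact h ⟨huv, f, hf, h2, h1⟩
        · exact hne rfl
  obtain ⟨C, hC⟩ := cover_ham hc hcov k Finset.univ (by rw [Finset.card_univ, hcard])
  refine partB (m := k + 5) (by omega) hOre (Finset.subset_union_left) hc ?_ _ C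
    (by simpa using hC) rfl
  intro f hf hfH
  rcases Finset.mem_union.1 hf with h | h
  · exact absurd h hfH
  · exact (Finset.mem_filter.1 h).2.2
end

section
/- Suppose H is a [3]-graph on n ≥ 69 vertices such that every pair of non-adjacent vertices u, v satisfies d_{∂H}(u) + d_{∂H}(v) ≥ n + 65, and H contains no Hamiltonian Berge cycle. Let C = v_1, e_1, ..., v_ℓ, e_ℓ, v_1 be a maximal Berge cycle in H with |V(C)| ∈ {n−1, n−2, n−3}, let u ∈ V(H) − V(C), and let U_u ⊆ V(C) be a usable set for u with |U_u| ≥ d_C(u)/6. Then for all distinct v_i, v_j ∈ U_u, |R(v_i, v_j)| ≥ d_C(v_i) + d_C(v_j) − |V(C)| − 4. -/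
theorem four_aux {V : Type*} [DecidableEq V] {f : Finset V} (hf : f.card ≤ 3) {a b c d : V}
    (ha : a ∈ f) (hb : b ∈ f) (hc : c ∈ f) (hd : d ∈ f)
    (hab : a ≠ b) (hac : a ≠ c) (had : a ≠ d) (hbc : b ≠ c) (hbd : b ≠ d) (hcd : c ≠ d) :
    False := by
  have hs : ({a, b, c, d} : Finset V) ⊆ f := by
    intro x hx
    simp only [Finset.mem_insert, Finset.mem_singleton] at hx
    rcases hx with rfl | rfl | rfl | rfl <;> assumption
  have h4 : ({a, b, c, d} : Finset V).card = 4 := by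
    rw [Finset.card_insert_of_notMem, Finset.card_insert_of_notMem,
      Finset.card_insert_of_notMem, Finset.card_singleton] <;> simp [*]
  have := Finset.card_le_card hs
  omega

theorem three_aux {V : Type*} [DecidableEq V] {f : Finset V} (hf : f.card ≤ 3) {a b c : V}
    (ha : a ∈ f) (hb : b ∈ f) (hc : c ∈ f)
    (hab : a ≠ b) (hac : a ≠ c) (hbc : b ≠ c) : f = {a, b, c} := by
  symm
  apply Finset.eq_of_subset_of_card_le
  · intro x hx
    simp only [Finset.mem_insert, Finset.mem_singleton] at hx
    rcases hx with rfl | rfl | rfl <;> assumption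
  · rw [Finset.card_insert_of_notMem, Finset.card_insert_of_notMem,
      Finset.card_singleton] <;> simp [*]

/-- Build a Berge cycle from sequences indexed by naturals. -/
theorem mkCycle {V : Type*} {H : Finset (Finset V)} (T : ℕ) (hT : 2 ≤ T)
    (p : ℕ → V) (q : ℕ → Finset V)
    (hp : ∀ x y, x < T → y < T → p x = p y → x = y)
    (hq : ∀ x y, x < T → y < T → q x = q y → x = y)
    (hm : ∀ x, x < T → q x ∈ H)
    (h1 : ∀ x, x < T → p x ∈ q x)
    (h2 : ∀ x, x + 1 < T → p (x + 1) ∈ q x)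
    (h3 : p 0 ∈ q (T - 1)) :
    ∃ C : BergeCycle H T, ∀ x, x < T → p x ∈ Set.range C.vtx := by
  have : NeZero T := ⟨by omega⟩
  have : Fact (1 < T) := ⟨by omega⟩
  refine ⟨⟨fun z => p z.val, fun z => q z.val, ?_, ?_, ?_, ?_, ?_⟩, ?_⟩
  · intro a b hab
    exact ZMod.val_injective T (hp _ _ (ZMod.val_lt a) (ZMod.val_lt b) hab)
  · intro a b hab
    exact ZMod.val_injective T (hq _ _ (ZMod.val_lt a) (ZMod.val_lt b) hab)
  · intro a; exact hm _ (ZMod.val_lt a)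
  · intro a; exact h1 _ (ZMod.val_lt a)
  · intro a
    have ha := ZMod.val_lt a
    simp only [ZMod.val_add, ZMod.val_one]
    by_cases h : a.val + 1 < T
    · rw [Nat.mod_eq_of_lt h]; exact h2 _ h
    · have : a.val + 1 = T := by omega
      rw [this, Nat.mod_self]
      have h' : a.val = T - 1 := by omega
      rw [h']; exact h3
  · intro x hx
    exact ⟨(x : ZMod T), by simp [ZMod.val_natCast, Nat.mod_eq_of_lt hx]⟩

/-- A maximal Berge cycle, unrolled along the naturals, together with an outside vertex. -/
structure Setup {V : Type*} (H : Finset (Finset V)) (t : ℕ) (u : V)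
    (w : ℕ → V) (E : ℕ → Finset V) : Prop where
  three : ∀ e ∈ H, e.card ≤ 3
  winj : ∀ x y, x < t → y < t → w x = w y → x = y
  einj : ∀ x y, x < t → y < t → E x = E y → x = y
  mem : ∀ x, E x ∈ H
  fst : ∀ x, w x ∈ E x
  snd : ∀ x, w (x + 1) ∈ E x
  wt : w t = w 0
  hu : ∀ x, u ≠ w x
  noc : ∀ C' : BergeCycle H (t + 1), u ∈ Set.range C'.vtx →
    (∀ x, x < t → w x ∈ Set.range C'.vtx) → False

theorem Setup.wne {V : Type*} {H : Finset (Finset V)} {t : ℕ} {u : V}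
    {w : ℕ → V} {E : ℕ → Finset V} (S : Setup H t u w E) {x y : ℕ} (hx : x < t) (hy : y < t)
    (h : x ≠ y) : w x ≠ w y := fun h' => h (S.winj x y hx hy h')

theorem Setup.edge_idx {V : Type*} [DecidableEq V] {H : Finset (Finset V)} {t : ℕ} {u : V}
    {w : ℕ → V} {E : ℕ → Finset V} (S : Setup H t u w E) {y : ℕ} (hy : y < t) (hy0 : 1 ≤ y)
    {e : Finset V}
    (hu : u ∈ e) (hey : w y ∈ e) (hne : e ≠ E (y - 1)) {x : ℕ} (hx : x < t) (h : e = E x) :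
    x = y := by
  by_contra hxy
  have hc : (E x).card ≤ 3 := S.three _ (S.mem x)
  have h1 := S.fst x
  have h2 := S.snd x
  rw [h] at hu hey
  have hx1 : x + 1 ≠ y := by
    intro h'
    apply hne
    rw [h]; congr 1; omega
  by_cases hxt : x + 1 < t
  · exact four_aux hc hu hey h1 h2 (S.hu _) (S.hu _) (S.hu _)
      (S.wne hy hx (by omega)) (S.wne hy hxt (by omega)) (S.wne hx hxt (by omega))
  · have hxt' : x + 1 = t := by omega
    rw [hxt', S.wt] at h2
    exact four_aux hc hu hey h1 h2 (S.hu _) (S.hu _) (S.hu _)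
      (S.wne hy hx (by omega)) (S.wne hy (by omega) (by omega)) (S.wne hx (by omega) (by omega))

/-- Insertion of `u` between `w (t-1)` and `w 0`. -/
theorem Setup.ins {V : Type*} [DecidableEq V] {H : Finset (Finset V)} {t : ℕ} {u : V}
    {w : ℕ → V} {E : ℕ → Finset V} (S : Setup H t u w E) {d : ℕ} (hd : 2 ≤ d) (hdt : d + 2 ≤ t)
    {e e' : Finset V} (he : e ∈ H) (he' : e' ∈ H) (hee : e ≠ e')
    (hue : u ∈ e) (hwe : w (t - 1) ∈ e) (hne : e ≠ E (t - 2))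
    (hue' : u ∈ e') (hwe' : w (d - 1) ∈ e') (hne' : e' ≠ E (d - 2))
    (h0 : w 0 ∈ e') : False := by
  have k1 : ∀ x, x < t - 1 → e ≠ E x := by
    intro x hx h
    have := S.edge_idx (y := t - 1) (by omega) (by omega) hue hwe hne (x := x) (by omega) h
    omega
  have k2 : ∀ x, x < t → e' ≠ E x := by
    intro x hx h
    have := S.edge_idx (y := d - 1) (by omega) (by omega) hue' hwe' hne' (x := x) hx h
    have h2 := S.snd x
    rw [← h] at h2
    exact four_aux (S.three _ he') hue' hwe' h0 h2 (S.hu _) (S.hu _) (S.hu _)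
      (S.wne (by omega) (by omega) (by omega)) (S.wne (by omega) (by omega) (by omega))
      (S.wne (by omega) (by omega) (by omega))
  obtain ⟨C', hC'⟩ := mkCycle (H := H) (t + 1) (by omega)
    (fun r => if r < t then w r else u)
    (fun r => if r < t - 1 then E r else if r < t then e else e') 
    (by
      intro x y hx hy h
      split_ifs at h
      · exact S.winj _ _ (by assumption) (by assumption) h
      · exact absurd h.symm (S.hu _)
      · exact absurd h (S.hu _)
      · omega)
    (by
      intro x y hx hy h
      split_ifs at h
      all_goals first
        | omega
        | exact S.einj _ _ (by omega) (by omega) h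
        | exact absurd h (k1 _ (by omega))
        | exact absurd h.symm (k1 _ (by omega))
        | exact absurd h (k2 _ (by omega))
        | exact absurd h.symm (k2 _ (by omega))
        | exact absurd h hee
        | exact absurd h.symm hee)
    (by
      intro x hx
      split_ifs
      · exact S.mem _
      · exact he
      · exact he')
    (by
      intro x hx
      split_ifs
      all_goals first
        | omega
        | exact S.fst _
        | assumption
        | (have : x = t - 1 := by omega
           subst this; exact hwe))
    (by
      intro x hx
      split_ifs
      all_goals first
        | omega
        | exact S.snd _
        | assumption)
    (by
      have a1 : ¬ (t + 1 - 1 < t - 1) := by omega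
      have a2 : ¬ (t + 1 - 1 < t) := by omega
      have a3 : 0 < t := by omega
      simp only [a1, a2, a3, if_true, if_false]
      exact h0)
  refine S.noc C' ?_ ?_
  · have := hC' t (by omega)
    simpa using this
  · intro x hx
    have := hC' x (by omega)
    simpa [hx] using this

set_option maxHeartbeats 2000000 in
theorem Setup.core {V : Type*} [DecidableEq V] {H : Finset (Finset V)} {t : ℕ} {u : V}
    {w : ℕ → V} {E : ℕ → Finset V} (S : Setup H t u w E) {d s : ℕ} (hdt : d + 2 ≤ t)
    (hs : 0 < s) (hsd : s + 1 < d)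
    {e e' f g : Finset V} (he : e ∈ H) (he' : e' ∈ H) (hf : f ∈ H) (hg : g ∈ H) (hee : e ≠ e')
    (hue : u ∈ e) (hwe : w (t - 1) ∈ e) (hne : e ≠ E (t - 2))
    (hue' : u ∈ e') (hwe' : w (d - 1) ∈ e') (hne' : e' ≠ E (d - 2))
    (h0 : w 0 ∉ e') (h0' : w d ∉ e)
    (hf0 : w 0 ∈ f) (hfs : w (s + 1) ∈ f) (hgd : w d ∈ g) (hgs : w s ∈ g) :
    w (s + 1) ∈ E 0 ∨ w s ∈ E d ∨ E (s + 1) = {w 0, w (s + 1), w (s + 2)} ∨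
      E (s - 1) = {w d, w s, w (s - 1)} := by
  by_contra hcon
  push Not at hcon
  obtain ⟨c1, c2, c3, c4⟩ := hcon
  have ke : ∀ x, x < t → x ≠ t - 1 → e ≠ E x := by
    intro x hx hx' h
    exact hx' (S.edge_idx (y := t - 1) (by omega) (by omega) hue hwe hne (x := x) (by omega) h)
  have ke' : ∀ x, x < t → x ≠ d - 1 → e' ≠ E x := by
    intro x hx hx' h
    exact hx' (S.edge_idx (y := d - 1) (by omega) (by omega) hue' hwe' hne' (x := x) (by omega) h)
  have kf : ∀ x, x < t → x ≠ t - 1 → x ≠ s → f ≠ E x := by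
    intro x hx hx1 hx2 h
    have a1 := S.fst x
    have a2 := S.snd x
    by_cases hx0 : x = 0
    · subst hx0; rw [h] at hfs; exact c1 hfs
    by_cases hx3 : x = s + 1
    · subst hx3
      rw [h] at hf0
      exact c3 (three_aux (S.three _ (S.mem _)) hf0 a1 a2 (S.wne (by omega) (by omega) (by omega))
        (S.wne (by omega) (by omega) (by omega)) (S.wne (by omega) (by omega) (by omega)))
    rw [h] at hf0 hfs
    exact four_aux (S.three _ (S.mem _)) hf0 hfs a1 a2
      (S.wne (by omega) (by omega) (by omega)) (S.wne (by omega) (by omega) (by omega))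
      (S.wne (by omega) (by omega) (by omega)) (S.wne (by omega) (by omega) (by omega))
      (S.wne (by omega) (by omega) (by omega)) (S.wne (by omega) (by omega) (by omega))
  have kg : ∀ x, x < t → x ≠ t - 1 → x ≠ d - 1 → x ≠ s → g ≠ E x := by
    intro x hx hx1 hx2 hx4 h
    have a1 := S.fst x
    have a2 := S.snd x
    by_cases hx0 : x = d
    · subst hx0; rw [h] at hgs; exact c2 hgs
    by_cases hx3 : x = s - 1
    · subst hx3
      rw [h] at hgd hgs
      exact c4 (three_aux (S.three _ (S.mem _)) hgd hgs a1 (S.wne (by omega) (by omega) (by omega))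
        (S.wne (by omega) (by omega) (by omega)) (S.wne (by omega) (by omega) (by omega)))
    rw [h] at hgd hgs
    exact four_aux (S.three _ (S.mem _)) hgd hgs a1 a2
      (S.wne (by omega) (by omega) (by omega)) (S.wne (by omega) (by omega) (by omega))
      (S.wne (by omega) (by omega) (by omega)) (S.wne (by omega) (by omega) (by omega))
      (S.wne (by omega) (by omega) (by omega)) (S.wne (by omega) (by omega) (by omega))
  have hfe : f ≠ e := by
    rintro rfl
    exact four_aux (S.three _ hf) hue hf0 hwe hfs (S.hu _) (S.hu _) (S.hu _)
      (S.wne (by omega) (by omega) (by omega)) (S.wne (by omega) (by omega) (by omega))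
      (S.wne (by omega) (by omega) (by omega))
  have hfe' : f ≠ e' := by rintro rfl; exact h0 hf0
  have hge : g ≠ e := by rintro rfl; exact h0' hgd
  have hge' : g ≠ e' := by
    rintro rfl
    exact four_aux (S.three _ hg) hue' hgd hwe' hgs (S.hu _) (S.hu _) (S.hu _)
      (S.wne (by omega) (by omega) (by omega)) (S.wne (by omega) (by omega) (by omega))
      (S.wne (by omega) (by omega) (by omega))
  have hfg : f ≠ g := by
    rintro rfl
    exact four_aux (S.three _ hf) hf0 hfs hgd hgs
      (S.wne (by omega) (by omega) (by omega)) (S.wne (by omega) (by omega) (by omega))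
      (S.wne (by omega) (by omega) (by omega)) (S.wne (by omega) (by omega) (by omega))
      (S.wne (by omega) (by omega) (by omega)) (S.wne (by omega) (by omega) (by omega))
  -- vertex and edge codes
  obtain ⟨cv, hcv⟩ : ∃ cv : ℕ → ℕ, ∀ r, cv r = if r ≤ s then r else if r ≤ s + t - d then
    d + r - s - 1 else if r = s + t - d + 1 then t else s + t + 1 - r := ⟨_, fun _ => rfl⟩
  obtain ⟨ce, hce⟩ : ∃ ce : ℕ → ℕ, ∀ r, ce r = if r < s then r else if r = s then t else
    if r < s + t - d then d + r - s - 1 else if r = s + t - d then t + 1 else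
    if r = s + t - d + 1 then t + 2 else if r < t then s + t - r else t + 3 := ⟨_, fun _ => rfl⟩
  obtain ⟨W, hW⟩ : ∃ W : ℕ → V, ∀ c, W c = if c < t then w c else u := ⟨_, fun _ => rfl⟩
  obtain ⟨Q, hQ⟩ : ∃ Q : ℕ → Finset V, ∀ c, Q c = if c < t then E c else if c = t then g else
    if c = t + 1 then e else if c = t + 2 then e' else f := ⟨_, fun _ => rfl⟩
  have W1 : ∀ c, c < t → W c = w c := fun c hc => by rw [hW, if_pos hc]
  have W2 : W t = u := by rw [hW, if_neg (by omega)]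
  have Q1 : ∀ c, c < t → Q c = E c := fun c hc => by rw [hQ, if_pos hc]
  have Q2 : Q t = g := by rw [hQ]; simp
  have Q3 : Q (t + 1) = e := by rw [hQ]; simp
  have Q4 : Q (t + 2) = e' := by rw [hQ]; simp
  have Q5 : Q (t + 3) = f := by rw [hQ]; simp
  have Winj : ∀ a b, a ≤ t → b ≤ t → W a = W b → a = b := by
    intro a b ha hb h
    rw [hW, hW] at h
    split_ifs at h
    · exact S.winj _ _ (by assumption) (by assumption) h
    · exact absurd h.symm (S.hu _)
    · exact absurd h (S.hu _)
    · omega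
  have Qinj : ∀ a b, a < b → b ≤ t + 3 → a ≠ t - 1 → a ≠ d - 1 → a ≠ s →
      b ≠ t - 1 → b ≠ d - 1 → b ≠ s → Q a ≠ Q b := by
    intro a b hab hb a1 a2 a3 b1 b2 b3
    have key : ∀ c, c < t ∨ c = t ∨ c = t + 1 ∨ c = t + 2 ∨ c = t + 3 ∨ t + 3 < c := by omega
    rcases key a with h | h | h | h | h | h <;> rcases key b with h' | h' | h' | h' | h' | h' <;>
      first
      | omega
      | skip
    · rw [Q1 a h, Q1 b h']; intro hh; exact absurd (S.einj _ _ h h' hh) (by omega)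
    · rw [Q1 a h, h', Q2]; exact (kg a h a1 a2 a3).symm
    · rw [Q1 a h, h', Q3]; exact (ke a h a1).symm
    · rw [Q1 a h, h', Q4]; exact (ke' a h a2).symm
    · rw [Q1 a h, h', Q5]; exact (kf a h a1 a3).symm
    · rw [h, h', Q2, Q3]; exact hge
    · rw [h, h', Q2, Q4]; exact hge'
    · rw [h, h', Q2, Q5]; exact hfg.symm
    · rw [h, h', Q3, Q4]; exact hee
    · rw [h, h', Q3, Q5]; exact hfe.symm
    · rw [h, h', Q4, Q5]; exact hfe'.symm
  have cvle : ∀ r, r ≤ t → cv r ≤ t := by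
    intro r hr; rw [hcv]; split_ifs <;> omega
  have cvinj : ∀ x y, x ≤ t → y ≤ t → cv x = cv y → x = y := by
    intro x y hx hy h; rw [hcv, hcv] at h; split_ifs at h <;> omega
  have cele : ∀ r, r ≤ t → ce r ≤ t + 3 ∧ ce r ≠ t - 1 ∧ ce r ≠ d - 1 ∧ ce r ≠ s := by
    intro r hr; rw [hce]; split_ifs <;> omega
  have ceinj : ∀ x y, x ≤ t → y ≤ t → ce x = ce y → x = y := by
    intro x y hx hy h; rw [hce, hce] at h; split_ifs at h <;> omega
  have regions : ∀ r, r ≤ t →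
      (∃ c, c < t ∧ ce r = c ∧ ((cv r = c ∧ cv (r + 1) = c + 1 ∧ c + 1 < t) ∨
        (cv r = c + 1 ∧ cv (r + 1) = c ∧ c + 1 < t)) ∧ r < t) ∨
      (ce r = t ∧ cv r = s ∧ cv (r + 1) = d ∧ r < t) ∨
      (ce r = t + 1 ∧ cv r = t - 1 ∧ cv (r + 1) = t ∧ r < t) ∨
      (ce r = t + 2 ∧ cv r = t ∧ cv (r + 1) = d - 1 ∧ r < t) ∨
      (ce r = t + 3 ∧ cv r = s + 1 ∧ r = t) := by
    intro r hr
    have : r < s ∨ r = s ∨ (s < r ∧ r < s + t - d) ∨ r = s + t - d ∨ r = s + t - d + 1 ∨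
      (s + t - d + 1 < r ∧ r < t) ∨ r = t := by omega
    rcases this with h | h | h | h | h | h | h
    · left; refine ⟨r, by omega, ?_, Or.inl ⟨?_, ?_, by omega⟩, by omega⟩
      · rw [hce]; split_ifs <;> omega
      · rw [hcv]; split_ifs <;> omega
      · rw [hcv]; split_ifs <;> omega
    · right; left; refine ⟨?_, ?_, ?_, by omega⟩
      · rw [hce]; split_ifs <;> omega
      · rw [hcv]; split_ifs <;> omega
      · rw [hcv]; split_ifs <;> omega
    · left; refine ⟨d + r - s - 1, by omega, ?_, Or.inl ⟨?_, ?_, by omega⟩, by omega⟩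
      · rw [hce]; split_ifs <;> omega
      · rw [hcv]; split_ifs <;> omega
      · rw [hcv]; split_ifs <;> omega
    · right; right; left; refine ⟨?_, ?_, ?_, by omega⟩
      · rw [hce]; split_ifs <;> omega
      · rw [hcv]; split_ifs <;> omega
      · rw [hcv]; split_ifs <;> omega
    · right; right; right; left; refine ⟨?_, ?_, ?_, by omega⟩
      · rw [hce]; split_ifs <;> omega
      · rw [hcv]; split_ifs <;> omega
      · rw [hcv]; split_ifs <;> omega
    · left; refine ⟨s + t - r, by omega, ?_, Or.inr ⟨?_, ?_, by omega⟩, by omega⟩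
      · rw [hce]; split_ifs <;> omega
      · rw [hcv]; split_ifs <;> omega
      · rw [hcv]; split_ifs <;> omega
    · right; right; right; right; refine ⟨?_, ?_, by omega⟩
      · rw [hce]; split_ifs <;> omega
      · rw [hcv]; split_ifs <;> omega
  obtain ⟨C', hC'⟩ := mkCycle (H := H) (t + 1) (by omega) (fun r => W (cv r)) (fun r => Q (ce r))
    (by
      intro x y hx hy h
      exact cvinj x y (by omega) (by omega)
        (Winj _ _ (cvle x (by omega)) (cvle y (by omega)) h))
    (by
      intro x y hx hy h
      apply ceinj x y (by omega) (by omega)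
      obtain ⟨x1, x2, x3, x4⟩ := cele x (by omega)
      obtain ⟨y1, y2, y3, y4⟩ := cele y (by omega)
      rcases Nat.lt_trichotomy (ce x) (ce y) with hlt | heq | hgt
      · exact absurd h (Qinj _ _ hlt y1 x2 x3 x4 y2 y3 y4)
      · exact heq
      · exact absurd h.symm (Qinj _ _ hgt x1 y2 y3 y4 x2 x3 x4))
    (by
      intro x hx
      change Q (ce x) ∈ H
      rw [hQ]
      split_ifs
      · exact S.mem _
      all_goals assumption)
    (by
      intro x hx
      change W (cv x) ∈ Q (ce x)
      rcases regions x (by omega) with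
        ⟨c, hc, h1, ⟨h2, h3, h4⟩ | ⟨h2, h3, h4⟩, _⟩ | ⟨h1, h2, h3, _⟩ | ⟨h1, h2, h3, _⟩ |
          ⟨h1, h2, h3, _⟩ | ⟨h1, h2, h3⟩
      · rw [h1, h2, Q1 c hc, W1 c hc]; exact S.fst c
      · rw [h1, h2, Q1 c hc, W1 _ h4]; exact S.snd c
      · rw [h1, h2, Q2, W1 _ (by omega)]; exact hgs
      · rw [h1, h2, Q3, W1 _ (by omega)]; exact hwe
      · rw [h1, h2, Q4, W2]; exact hue'
      · rw [h1, h2, Q5, W1 _ (by omega)]; exact hfs)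
    (by
      intro x hx
      change W (cv (x + 1)) ∈ Q (ce x)
      rcases regions x (by omega) with
        ⟨c, hc, h1, ⟨h2, h3, h4⟩ | ⟨h2, h3, h4⟩, _⟩ | ⟨h1, h2, h3, _⟩ | ⟨h1, h2, h3, _⟩ |
          ⟨h1, h2, h3, _⟩ | ⟨h1, h2, h3⟩
      · rw [h1, h3, Q1 c hc, W1 _ h4]; exact S.snd c
      · rw [h1, h3, Q1 c hc, W1 _ hc]; exact S.fst c
      · rw [h1, h3, Q2, W1 _ (by omega)]; exact hgd
      · rw [h1, h3, Q3, W2]; exact hue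
      · rw [h1, h3, Q4, W1 _ (by omega)]; exact hwe'
      · omega)
    (by
      change W (cv 0) ∈ Q (ce (t + 1 - 1))
      have z0 : cv 0 = 0 := by rw [hcv]; simp
      have z1 : ce (t + 1 - 1) = t + 3 := by rw [hce]; split_ifs <;> omega
      rw [z0, z1, Q5, W1 0 (by omega)]; exact hf0)
  have hit : ∀ r c, r ≤ t → cv r = c → W c ∈ Set.range C'.vtx := by
    intro r c hr h
    have := hC' r (by omega)
    rw [← h]; exact this
  refine S.noc C' ?_ ?_
  · rw [← W2]
    refine hit (s + t - d + 1) t (by omega) ?_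
    rw [hcv]; split_ifs <;> omega
  · intro x hx
    rw [← W1 x hx]
    have : x ≤ s ∨ d ≤ x ∨ (s < x ∧ x < d) := by omega
    rcases this with h | h | h
    · refine hit x x (by omega) ?_
      rw [hcv]; split_ifs <;> omega
    · refine hit (x - d + s + 1) x (by omega) ?_
      rw [hcv]; split_ifs <;> omega
    · refine hit (s + t + 1 - x) x (by omega) ?_
      rw [hcv]; split_ifs <;> omega

/-- The bridges in unrolled form. -/
def Br {V : Type*} [DecidableEq V] (t d : ℕ) (w : ℕ → V) (E : ℕ → Finset V) (s : ℕ)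
    (b : Finset V) : Prop :=
  (0 < s ∧ s + 1 < d ∧ ((b = E (s + 1) ∧ b = {w 0, w (s + 1), w (s + 2)}) ∨
    (b = E (s - 1) ∧ b = {w d, w s, w (s - 1)}))) ∨
  (d < s ∧ s + 1 < t ∧ ((b = E (s - 1) ∧ b = {w 0, w s, w (s - 1)}) ∨
    (b = E (s + 1) ∧ b = {w d, w (s + 1), w (s + 2)})))

theorem Br_inj {V : Type*} [DecidableEq V] {H : Finset (Finset V)} {t : ℕ} {u : V}
    {w : ℕ → V} {E : ℕ → Finset V} (S : Setup H t u w E) {d : ℕ} (hd : 2 ≤ d) (hdt : d + 2 ≤ t)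
    {s s' : ℕ} {b : Finset V} (h : Br t d w E s b) (h' : Br t d w E s' b) : s = s' := by
  have mem3 : ∀ x a1 a2 a3, w x ∈ ({w a1, w a2, w a3} : Finset V) → x < t → a1 < t → a2 < t →
      a3 < t → x = a1 ∨ x = a2 ∨ x = a3 := by
    intro x a1 a2 a3 hx h0 h1 h2 h3
    simp only [Finset.mem_insert, Finset.mem_singleton] at hx
    rcases hx with hx | hx | hx
    · exact Or.inl (S.winj _ _ h0 h1 hx)
    · exact Or.inr (Or.inl (S.winj _ _ h0 h2 hx))
    · exact Or.inr (Or.inr (S.winj _ _ h0 h3 hx))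
  -- the two mixed cases
  have mixL : ∀ s s', s + 1 < d → 0 < s' → s' + 1 < d → s + 1 = s' - 1 →
      ({w 0, w (s + 1), w (s + 2)} : Finset V) = {w d, w s', w (s' - 1)} → False := by
    intro s s' h1 h0 h2 h3 h4
    have : w d ∈ ({w 0, w (s + 1), w (s + 2)} : Finset V) := by rw [h4]; simp
    have := mem3 _ _ _ _ this (by omega) (by omega) (by omega) (by omega)
    omega
  have mixR : ∀ s s', d < s → d < s' → s + 1 < t → s' + 1 < t → s - 1 = s' + 1 →
      ({w 0, w s, w (s - 1)} : Finset V) = {w d, w (s' + 1), w (s' + 2)} → False := by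
    intro s s' h1 h0 h2 h5 h3 h4
    have : w d ∈ ({w 0, w s, w (s - 1)} : Finset V) := by rw [h4]; simp
    have := mem3 _ _ _ _ this (by omega) (by omega) (by omega) (by omega)
    omega
  rcases h with ⟨a1, a2, ⟨a3, a4⟩ | ⟨a3, a4⟩⟩ | ⟨a1, a2, ⟨a3, a4⟩ | ⟨a3, a4⟩⟩ <;>
  rcases h' with ⟨b1, b2, ⟨b3, b4⟩ | ⟨b3, b4⟩⟩ | ⟨b1, b2, ⟨b3, b4⟩ | ⟨b3, b4⟩⟩ <;>
  have hh := S.einj _ _ (by omega) (by omega) (a3.symm.trans b3) <;>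
  first
  | omega
  | exact (mixL _ _ a2 b1 b2 hh (a4.symm.trans b4)).elim
  | exact (mixL _ _ b2 a1 a2 hh.symm (b4.symm.trans a4)).elim
  | exact (mixR _ _ a1 b1 a2 b2 hh (a4.symm.trans b4)).elim
  | exact (mixR _ _ b1 a1 b2 a2 hh.symm (b4.symm.trans a4)).elim

theorem Setup.exc {V : Type*} [DecidableEq V] {H : Finset (Finset V)} {t : ℕ} {u : V}
    {w : ℕ → V} {E : ℕ → Finset V} (S : Setup H t u w E) {c : ℕ} (hc : c + 1 < t)
    (a : ℕ → ℕ) (P : Finset ℕ)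
    (hP : ∀ x ∈ P, a x < t ∧ a x ≠ c ∧ a x ≠ c + 1 ∧ w (a x) ∈ E c)
    (hinj : ∀ x ∈ P, ∀ y ∈ P, a x = a y → x = y) : P.card ≤ 1 := by
  rw [Finset.card_le_one]
  intro x hx y hy
  apply hinj x hx y hy
  by_contra hne
  obtain ⟨x1, x2, x3, x4⟩ := hP x hx
  obtain ⟨y1, y2, y3, y4⟩ := hP y hy
  exact four_aux (S.three _ (S.mem c)) x4 y4 (S.fst c) (S.snd c)
    (S.wne x1 y1 hne) (S.wne x1 (by omega) x2) (S.wne x1 hc x3)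
    (S.wne y1 (by omega) y2) (S.wne y1 hc y3) (S.wne (by omega) hc (by omega))

theorem count_aux {V : Type*} [DecidableEq V] {H : Finset (Finset V)} {t : ℕ} {u : V}
    {w : ℕ → V} {E : ℕ → Finset V} (S : Setup H t u w E) {d : ℕ} (hd : 2 ≤ d) (hdt : d + 2 ≤ t)
    (S' : Setup H t u (fun x => w (d + x)) (fun x => E (d + x)))
    (pw : ∀ x, w (x + t) = w x) (pE : ∀ x, E (x + t) = E x)
    {e e' : Finset V} (he : e ∈ H) (he' : e' ∈ H) (hee : e ≠ e')
    (hue : u ∈ e) (hwe : w (t - 1) ∈ e) (hne : e ≠ E (t - 2))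
    (hue' : u ∈ e') (hwe' : w (d - 1) ∈ e') (hne' : e' ≠ E (d - 2)) :
    ∃ G : Finset ℕ, {x | x < t ∧ HAdj H (w 0) (w x)}.ncard + {x | x < t ∧ HAdj H (w d) (w x)}.ncard
      ≤ t + 4 + G.card ∧ ∀ s ∈ G, ∃ b, Br t d w E s b := by
  classical
  have q1 : w (d + (t - 1)) = w (d - 1) := by rw [← pw (d - 1)]; congr 1; omega
  have q2 : E (d + (t - 2)) = E (d - 2) := by rw [← pE (d - 2)]; congr 1; omega
  have q3 : d + (t - d - 1) = t - 1 := by omega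
  have q4 : d + (t - d - 2) = t - 2 := by omega
  have q5 : d + (t - d) = t := by omega
  have q6 : w t = w 0 := S.wt
  have q7 : E t = E 0 := by simpa using pE 0
  have h0 : w 0 ∉ e' := fun h =>
    S.ins hd hdt he he' hee hue hwe hne hue' hwe' hne' h
  have h0' : w d ∉ e := fun h =>
    S'.ins (d := t - d) (by omega) (by omega) he' he hee.symm hue' (by rw [q1]; exact hwe')
      (by rw [q2]; exact hne') hue (by rw [q3]; exact hwe) (by rw [q4]; exact hne) h
  obtain ⟨a, ha⟩ : ∃ a : ℕ → ℕ, ∀ s, a s = if s < d then s + 1 else s := ⟨_, fun _ => rfl⟩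
  obtain ⟨b, hb⟩ : ∃ b : ℕ → ℕ, ∀ s, b s = if s < d then s else s + 1 := ⟨_, fun _ => rfl⟩
  set A := (Finset.range t).filter (fun s => s ≠ d - 1 ∧ HAdj H (w 0) (w (a s))) with hA
  set B := (Finset.range t).filter (fun s => s ≠ t - 1 ∧ HAdj H (w d) (w (b s))) with hB
  have cA : {x | x < t ∧ HAdj H (w 0) (w x)}.ncard ≤ A.card := by
    rw [← Set.ncard_coe_finset A]
    refine le_trans (Set.ncard_le_ncard ?_ ((Set.toFinite (A : Set ℕ)).image a))
      (Set.ncard_image_le (Set.toFinite _))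
    rintro x ⟨hx, hadj⟩
    have hx0 : x ≠ 0 := by rintro rfl; exact hadj.1 rfl
    by_cases h : x < d
    · have hax : a (x - 1) = x := by rw [ha]; split_ifs <;> omega
      refine ⟨x - 1, ?_, hax⟩
      simp only [hA, Finset.coe_filter, Finset.mem_range, Set.mem_ofPred_eq, hax]
      exact ⟨by omega, by omega, hadj⟩
    · have hax : a x = x := by rw [ha]; split_ifs; rfl
      refine ⟨x, ?_, hax⟩
      simp only [hA, Finset.coe_filter, Finset.mem_range, Set.mem_ofPred_eq, hax]
      exact ⟨by omega, by omega, hadj⟩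
  have cB : {x | x < t ∧ HAdj H (w d) (w x)}.ncard ≤ B.card := by
    rw [← Set.ncard_coe_finset B]
    refine le_trans (Set.ncard_le_ncard ?_ ((Set.toFinite (B : Set ℕ)).image b))
      (Set.ncard_image_le (Set.toFinite _))
    rintro x ⟨hx, hadj⟩
    have hx0 : x ≠ d := by rintro rfl; exact hadj.1 rfl
    by_cases h : d < x
    · have hax : b (x - 1) = x := by rw [hb]; split_ifs <;> omega
      refine ⟨x - 1, ?_, hax⟩
      simp only [hB, Finset.coe_filter, Finset.mem_range, Set.mem_ofPred_eq, hax]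
      exact ⟨by omega, by omega, hadj⟩
    · have hax : b x = x := by rw [hb]; split_ifs <;> omega
      refine ⟨x, ?_, hax⟩
      simp only [hB, Finset.coe_filter, Finset.mem_range, Set.mem_ofPred_eq, hax]
      exact ⟨by omega, by omega, hadj⟩
  have cU : (A ∪ B).card ≤ t := by
    have : A ∪ B ⊆ Finset.range t :=
      Finset.union_subset (Finset.filter_subset _ _) (Finset.filter_subset _ _)
    simpa using Finset.card_le_card this
  have cI := Finset.card_union_add_card_inter A B
  have memAB : ∀ s ∈ A ∩ B, s < t ∧ s ≠ d - 1 ∧ s ≠ t - 1 ∧ HAdj H (w 0) (w (a s)) ∧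
      HAdj H (w d) (w (b s)) := by
    intro s hs
    simp only [hA, hB, Finset.mem_inter, Finset.mem_filter, Finset.mem_range] at hs
    tauto
  set P1 := (A ∩ B).filter (fun s => s ≠ 0 ∧ w (a s) ∈ E 0) with hP1
  set P2 := (A ∩ B).filter (fun s => s ≠ d ∧ w (b s) ∈ E d) with hP2
  have c1 : P1.card ≤ 1 := by
    refine S.exc (c := 0) (by omega) a P1 ?_ ?_
    · intro x hx
      obtain ⟨hx1, hx2, hx3⟩ := Finset.mem_filter.1 hx
      obtain ⟨y1, y2, y3, -, -⟩ := memAB x hx1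
      refine ⟨?_, ?_, ?_, hx3⟩ <;> rw [ha] <;> split_ifs <;> omega
    · intro x hx y hy h
      obtain ⟨x1, x2, x3, -, -⟩ := memAB x (Finset.mem_filter.1 hx).1
      obtain ⟨y1, y2, y3, -, -⟩ := memAB y (Finset.mem_filter.1 hy).1
      rw [ha, ha] at h; split_ifs at h <;> omega
  have c2 : P2.card ≤ 1 := by
    refine S.exc (c := d) (by omega) b P2 ?_ ?_
    · intro x hx
      obtain ⟨hx1, hx2, hx3⟩ := Finset.mem_filter.1 hx
      obtain ⟨y1, y2, y3, -, -⟩ := memAB x hx1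
      refine ⟨?_, ?_, ?_, hx3⟩ <;> rw [hb] <;> split_ifs <;> omega
    · intro x hx y hy h
      obtain ⟨x1, x2, x3, -, -⟩ := memAB x (Finset.mem_filter.1 hx).1
      obtain ⟨y1, y2, y3, -, -⟩ := memAB y (Finset.mem_filter.1 hy).1
      rw [hb, hb] at h; split_ifs at h <;> omega
  refine ⟨(A ∩ B) \ (({0, d} : Finset ℕ) ∪ (P1 ∪ P2)), ?_, ?_⟩
  · have k1 := Finset.le_card_sdiff (({0, d} : Finset ℕ) ∪ (P1 ∪ P2)) (A ∩ B)
    have k2 := Finset.card_union_le ({0, d} : Finset ℕ) (P1 ∪ P2)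
    have k3 := Finset.card_union_le P1 P2
    have k4 := Finset.card_le_two (a := 0) (b := d)
    omega
  · intro s hs
    rw [Finset.mem_sdiff] at hs
    obtain ⟨hs, hn⟩ := hs
    simp only [Finset.mem_union, Finset.mem_insert, Finset.mem_singleton, not_or] at hn
    obtain ⟨⟨n0, nd⟩, n1, n2⟩ := hn
    have n1' : w (a s) ∉ E 0 := fun h => n1 (Finset.mem_filter.2 ⟨hs, n0, h⟩)
    have n2' : w (b s) ∉ E d := fun h => n2 (Finset.mem_filter.2 ⟨hs, nd, h⟩)
    obtain ⟨x1, x2, x3, ⟨-, f, hf, hf0, hfs⟩, ⟨-, g, hg, hgd, hgs⟩⟩ := memAB s hs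
    by_cases hsd : s < d
    · have as : a s = s + 1 := by rw [ha, if_pos hsd]
      have bs : b s = s := by rw [hb, if_pos hsd]
      rw [as] at n1' hfs
      rw [bs] at n2' hgs
      rcases S.core hdt (by omega) (by omega) he he' hf hg hee hue hwe hne hue' hwe' hne' h0 h0'
        hf0 hfs hgd hgs with h | h | h | h
      · exact absurd h n1'
      · exact absurd h n2'
      · exact ⟨_, Or.inl ⟨by omega, by omega, Or.inl ⟨rfl, h⟩⟩⟩
      · exact ⟨_, Or.inl ⟨by omega, by omega, Or.inr ⟨rfl, h⟩⟩⟩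
    · have as : a s = s := by rw [ha, if_neg hsd]
      have bs : b s = s + 1 := by rw [hb, if_neg hsd]
      rw [as] at n1' hfs
      rw [bs] at n2' hgs
      have r1 : d + (s - d) = s := by omega
      have r2 : d + (s - d + 1) = s + 1 := by omega
      have r3 : d + (s - d + 2) = s + 2 := by omega
      have r4 : d + (s - d - 1) = s - 1 := by omega
      have := S'.core (d := t - d) (s := s - d) (e := e') (e' := e) (f := g) (g := f)
        (by omega) (by omega) (by omega) he' he hg hf hee.symm hue' (by rw [q1]; exact hwe')
        (by rw [q2]; exact hne') hue (by rw [q3]; exact hwe) (by rw [q4]; exact hne)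
        h0' (by rw [q5, q6]; exact h0) hgd (by rw [r2]; exact hgs) (by rw [q5, q6]; exact hf0)
        (by rw [r1]; exact hfs)
      simp only [q5, q6, q7, r1, r2, r3, r4, add_zero] at this
      rcases this with h | h | h | h
      · exact absurd h n2'
      · exact absurd h n1'
      · exact ⟨_, Or.inr ⟨by omega, by omega, Or.inr ⟨rfl, h⟩⟩⟩
      · exact ⟨_, Or.inr ⟨by omega, by omega, Or.inl ⟨rfl, h⟩⟩⟩

theorem setup_of {V : Type*} {H : Finset (Finset V)} (h3 : IsThreeGraph H)
    {t : ℕ} (ht : 2 ≤ t) (C : BergeCycle H t)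
    (hmax : ¬ ∃ (t' : ℕ) (C' : BergeCycle H t'),
      Set.range C.vtx ⊂ Set.range C'.vtx)
    (u : V) (hu : u ∉ Set.range C.vtx) (i : ZMod t) :
    Setup H t u (fun x => C.vtx (i + (x : ℕ))) (fun x => C.edge (i + (x : ℕ))) := by
  have : NeZero t := ⟨by omega⟩
  have cinj : ∀ x y : ℕ, x < t → y < t → i + (x : ZMod t) = i + (y : ZMod t) → x = y := by
    intro x y hx hy h
    have h' := congrArg ZMod.val (add_left_cancel h)
    rwa [ZMod.val_natCast_of_lt hx, ZMod.val_natCast_of_lt hy] at h'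
  constructor
  · intro e he; rcases h3 e he with h | h <;> omega
  · intro x y hx hy h; exact cinj x y hx hy (C.vtx_inj h)
  · intro x y hx hy h; exact cinj x y hx hy (C.edge_inj h)
  · intro x; exact C.edge_mem _
  · intro x; exact C.mem_fst _
  · intro x
    have := C.mem_snd (i + (x : ZMod t))
    simpa [add_assoc] using this
  · simp
  · rintro x rfl; exact hu ⟨_, rfl⟩
  · intro C' h1 h2
    refine hmax ⟨_, C', ?_⟩
    refine ⟨?_, fun h => hu (h h1)⟩
    rintro _ ⟨z, rfl⟩
    have := h2 (z - i).val (ZMod.val_lt _)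
    simpa using this

/-- Lemma 5(c): for all distinct `v_i, v_j` in the usable set,
`|R(v_i, v_j)| ≥ d_C(v_i) + d_C(v_j) - |V(C)| - 4`. -/
theorem stmt10 {V : Type*} [Fintype V] [DecidableEq V] (n : ℕ) (hn : 69 ≤ n)
    (hcard : Fintype.card V = n) (H : Finset (Finset V)) (h3 : IsThreeGraph H)
    (hOre : ∀ u v : V, u ≠ v → ¬ HAdj H u v →
      n + 65 ≤ shadowDeg H u + shadowDeg H v)
    (hnoham : ¬ HamiltonianBergeCycle H)
    {t : ℕ} (C : BergeCycle H t)
    (hmax : ¬ ∃ (t' : ℕ) (C' : BergeCycle H t'),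
      Set.range C.vtx ⊂ Set.range C'.vtx)
    (ht : t = n - 1 ∨ t = n - 2 ∨ t = n - 3)
    (u : V) (hu : u ∉ Set.range C.vtx)
    (U : Set (ZMod t)) (hU : Usable C u U) (hUcard : (C.dC u : ℚ) / 6 ≤ U.ncard)
    (i j : ZMod t) (hi : i ∈ U) (hj : j ∈ U) (hij : i ≠ j) :
    (C.dC (C.vtx i) : ℤ) + (C.dC (C.vtx j) : ℤ) - ((Set.range C.vtx).ncard : ℤ) - 4
      ≤ ((RBridges C i j).ncard : ℤ) := by

  have ht66 : 66 ≤ t := by omega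
  have : NeZero t := ⟨by omega⟩
  have hfin : Finite V := inferInstance
  obtain ⟨d, hd⟩ : ∃ d, d = (j - i).val := ⟨_, rfl⟩
  have hdlt : d < t := hd ▸ ZMod.val_lt _
  have hj' : j = i + (d : ZMod t) := by rw [hd]; simp
  have hd0 : d ≠ 0 := by rintro h; rw [h] at hj'; simp at hj'; exact hij hj'.symm
  have hd1 : d ≠ 1 := by
    rintro h; rw [h] at hj'; simp at hj'; exact (hU.2.1 i hi j hj hij).1 hj'
  have cs : ∀ a, a ≤ t → (((t - a : ℕ)) : ZMod t) = -(a : ZMod t) := by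
    intro a ha; rw [Nat.cast_sub ha]; simp
  have hd2 : d ≠ t - 1 := by
    rintro h; rw [h, cs 1 (by omega)] at hj'
    exact (hU.2.1 i hi j hj hij).2 (by rw [hj']; simp [sub_eq_add_neg])
  have S := setup_of h3 (by omega) C hmax u hu i
  have S' : Setup H t u (fun x => C.vtx (i + ((d + x : ℕ) : ZMod t)))
      (fun x => C.edge (i + ((d + x : ℕ) : ZMod t))) := by
    have := setup_of h3 (by omega) C hmax u hu j
    simpa [hj', add_assoc] using this
  obtain ⟨e, he, e', he', hee, hne, hue, hwe, hne', hue', hwe'⟩ := hU.2.2 i hi j hj hij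
  have z1 : i + ((t - 1 : ℕ) : ZMod t) = i - 1 := by rw [cs 1 (by omega)]; simp [sub_eq_add_neg]
  have z2 : i + ((t - 2 : ℕ) : ZMod t) = i - 2 := by rw [cs 2 (by omega)]; simp [sub_eq_add_neg]
  have z3 : i + ((d - 1 : ℕ) : ZMod t) = j - 1 := by
    rw [hj', Nat.cast_sub (by omega)]; push_cast; ring
  have z4 : i + ((d - 2 : ℕ) : ZMod t) = j - 2 := by
    rw [hj', Nat.cast_sub (by omega)]; push_cast; ring
  obtain ⟨G, hG1, hG2⟩ := count_aux S (d := d) (by omega) (by omega) S'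
    (by intro x; simp) (by intro x; simp) he he' hee hue
    (by rw [z1]; exact hwe) (by rw [z2]; exact hne) hue' (by rw [z3]; exact hwe')
    (by rw [z4]; exact hne')
  have rng : (Set.range C.vtx).ncard = t := by
    rw [← Set.image_univ, Set.ncard_image_of_injective _ C.vtx_inj, Set.ncard_univ]
    simp
  have dC : ∀ v, C.dC v ≤ {x : ℕ | x < t ∧ HAdj H v (C.vtx (i + (x : ZMod t)))}.ncard := by
    intro v
    have hfx : {x : ℕ | x < t ∧ HAdj H v (C.vtx (i + (x : ZMod t)))}.Finite :=
      (Set.finite_lt_nat t).subset (fun x hx => hx.1)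
    refine le_trans (Set.ncard_le_ncard ?_ (hfx.image (fun x : ℕ => C.vtx (i + (x : ZMod t)))))
      (Set.ncard_image_le hfx)
    rintro _ ⟨⟨z, rfl⟩, hz⟩
    refine ⟨(z - i).val, ⟨ZMod.val_lt _, ?_⟩, ?_⟩
    · simpa using hz
    · simp
  have hRG : G.card ≤ (RBridges C i j).ncard := by
    choose! φ hφ using hG2
    rw [← Set.ncard_coe_finset G]
    refine Set.ncard_le_ncard_of_injOn φ ?_ ?_ (Set.toFinite _)
    · intro s hs
      have h := hφ s hs
      have hst : s < t := by rcases h with h | h <;> omega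
      have vs : ((i + (s : ZMod t)) - i).val = s := by
        rw [add_sub_cancel_left, ZMod.val_natCast_of_lt hst]
      have e0 : ((s : ℕ) : ZMod t) + 1 = ((s + 1 : ℕ) : ZMod t) := by push_cast; rfl
      have hs0 : 0 < s := by rcases h with h | h <;> omega
      have hsne : s ≠ d := by rcases h with h | h <;> omega
      have w1 : i + (s : ZMod t) + 1 = i + ((s + 1 : ℕ) : ZMod t) := by push_cast; ring
      have w2 : i + (s : ZMod t) + 2 = i + ((s + 2 : ℕ) : ZMod t) := by push_cast; ring
      have w3 : i + (s : ZMod t) - 1 = i + ((s - 1 : ℕ) : ZMod t) := by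
        rw [Nat.cast_sub (by omega)]; push_cast; ring
      refine ⟨i + (s : ZMod t), ?_, ?_, ?_⟩
      · intro h'
        rw [h'] at vs; simp at vs; omega
      · intro h'
        rw [h', ← hd] at vs; omega
      · unfold IsBridge
        rw [w1, w2, w3]
        rcases h with ⟨h1, h2, h⟩ | ⟨h1, h2, h⟩
        · left
          refine ⟨⟨by rw [vs]; omega, by rw [vs, ← hd]; omega⟩, ?_⟩
          simpa [hj'] using h
        · right
          have v1 : ((i + (s : ZMod t)) - j).val = s - d := by
            have : (i + (s : ZMod t)) - j = ((s - d : ℕ) : ZMod t) := by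
              rw [hj', Nat.cast_sub (by omega)]; ring
            rw [this, ZMod.val_natCast_of_lt (by omega)]
          have v2 : (i - j).val = t - d := by
            have : i - j = ((t - d : ℕ) : ZMod t) := by
              rw [cs d (by omega), hj']; ring
            rw [this, ZMod.val_natCast_of_lt (by omega)]
          refine ⟨⟨by rw [v1]; omega, by rw [v1, v2]; omega⟩, ?_⟩
          simpa [hj'] using h
    · intro s hs s' hs' hss
      have k1 := hφ s hs
      have k2 := hφ s' hs'
      rw [← hss] at k2
      exact Br_inj S (by omega) (by omega) k1 k2
  have d1 := dC (C.vtx i)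
  have d2 := dC (C.vtx j)
  simp only [Nat.cast_zero, add_zero, ← hj'] at hG1
  rw [rng]
  omega
end
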